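/- arXiv:2311.11443 — 2 statements merged into one kernel-verified Lean document; each statement's English description precedes it below -/
import Mathlib

section
/- For every n ∈ ℕ there is a family (N_m^n)_{m ≥ 1} of high-level Petri nets in the class Nf, where N_m^n has color set {0,…,m}, such that: (i) there is a complete finite prefix of the symbolic unfolding Υ(N_m^n) whose number of nodes is the same for every m; and (ii) every complete prefix of the unfolding of the expansion Exp(N_m^n) has more than m^n nodes. -/
/-
Core formalization of high-level Petri nets, symbolic unfoldings,
branching processes, configurations, adequate orders, cut-off events,
expansions and constraints, following Würdemann–Chatain–Haar–Panneke,
"Taking Complete Finite Prefixes To High Level, Symbolically".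
-/

noncomputable section
open scoped Classical

/-- A high-level Petri net over a set `Color` of colors and a set `Var` of variables:
places, transitions, a flow function (given by the multisets of `(place, variable)`
pairs on the input resp. output arcs of each transition), a guard for each transition
(a predicate on the assignments of colors to variables), and a set of initial markings. -/
structure HLNet (Color : Type) (Var : Type) : Type 1 where
  Place : Type
  Trans : Type
  preFlow : Trans → Multiset (Place × Var)
  postFlow : Trans → Multiset (Place × Var)
  guard : Trans → (Var → Color) → Prop
  init : Set (Multiset (Place × Color))

namespace HLNet

variable {Color Var : Type}

/-- A marking: a multiset over `Place × Color`. -/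
abbrev Marking (N : HLNet Color Var) : Type := Multiset (N.Place × Color)

/-- Well-formedness: the set of initial markings is nonempty, and all initial markings
mark the same places with the same numbers of colors. -/
def WellFormed (N : HLNet Color Var) : Prop :=
  N.init.Nonempty ∧
    ∀ M ∈ N.init, ∀ M' ∈ N.init, Multiset.map Prod.fst M = Multiset.map Prod.fst M'

/-- The net is finite: finitely many places and transitions
(the support of the flow function is then automatically finite). -/
def NetFinite (N : HLNet Color Var) : Prop := Finite N.Place ∧ Finite N.Trans

/-- The guards are written in a decidable theory (stand-in: each guard is a
decidable predicate on modes). -/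
def DecidableGuards (N : HLNet Color Var) : Prop :=
  ∀ t σ, Nonempty (Decidable (N.guard t σ))

/-- `•(t,σ)`, the multiset of colored tokens consumed by transition `t` fired in mode `σ`. -/
def preMark (N : HLNet Color Var) (t : N.Trans) (σ : Var → Color) : N.Marking :=
  (N.preFlow t).map fun pv => (pv.1, σ pv.2)

/-- `(t,σ)•`, the multiset of colored tokens produced by transition `t` fired in mode `σ`. -/
def postMark (N : HLNet Color Var) (t : N.Trans) (σ : Var → Color) : N.Marking :=
  (N.postFlow t).map fun pv => (pv.1, σ pv.2)

/-- `M[t,σ⟩`: transition `t` can fire in mode `σ` from marking `M`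
(`σ` is a mode of `t`, i.e. the guard holds, and `•(t,σ) ≤ M`). -/
def fires (N : HLNet Color Var) (M : N.Marking) (t : N.Trans) (σ : Var → Color) : Prop :=
  N.guard t σ ∧ N.preMark t σ ≤ M

/-- `M[t,σ⟩M'`: firing `t` in mode `σ` from `M` yields `M'`. -/
def firesTo (N : HLNet Color Var) (M : N.Marking) (t : N.Trans) (σ : Var → Color)
    (M' : N.Marking) : Prop :=
  N.fires M t σ ∧ M' = (M - N.preMark t σ) + N.postMark t σ

/-- `R(N)`: the markings reachable from some initial marking by finitely many firings. -/
inductive Reach (N : HLNet Color Var) : N.Marking → Prop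
  | init {M : N.Marking} : M ∈ N.init → Reach N M
  | step {M : N.Marking} {t : N.Trans} {σ : Var → Color} {M' : N.Marking} :
      Reach N M → N.firesTo M t σ M' → Reach N M'

/-- The markings reachable in exactly `n` firings. -/
def ReachSteps (N : HLNet Color Var) : ℕ → N.Marking → Prop
  | 0, M => M ∈ N.init
  | n + 1, M' => ∃ M t σ, ReachSteps N n M ∧ N.firesTo M t σ M'

/-- Every reachable marking is reachable by firing at most `n` transitions. -/
def BoundedReach (N : HLNet Color Var) (n : ℕ) : Prop :=
  ∀ M, N.Reach M → ∃ k ≤ n, N.ReachSteps k M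

/-- Safety: in every reachable marking every place holds at most one color. -/
def Safe (N : HLNet Color Var) : Prop :=
  ∀ M, N.Reach M → ∀ p : N.Place, (M.filter fun pc => pc.1 = p).card ≤ 1

/-- Nodes of the net: places and transitions. -/
abbrev Node (N : HLNet Color Var) : Type := N.Place ⊕ N.Trans

/-- The arc relation `x → y` between nodes. -/
def arc (N : HLNet Color Var) : N.Node → N.Node → Prop
  | Sum.inl b, Sum.inr t => ∃ v, (b, v) ∈ N.preFlow t
  | Sum.inr t, Sum.inl b => ∃ v, (b, v) ∈ N.postFlow t
  | Sum.inl _, Sum.inl _ => False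
  | Sum.inr _, Sum.inr _ => False

/-- The causality relation `<` (irreflexive transitive closure of the arc relation). -/
def clt (N : HLNet Color Var) : N.Node → N.Node → Prop := Relation.TransGen N.arc

/-- The causality relation `≤` (reflexive transitive closure of the arc relation). -/
def cle (N : HLNet Color Var) : N.Node → N.Node → Prop := Relation.ReflTransGen N.arc

/-- `<` on transitions/events. -/
def evLT (N : HLNet Color Var) (e e' : N.Trans) : Prop := N.clt (Sum.inr e) (Sum.inr e')

/-- `≤` on transitions/events. -/
def evLE (N : HLNet Color Var) (e e' : N.Trans) : Prop := N.cle (Sum.inr e) (Sum.inr e')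

/-- Structural conflict `x ♯ y`: distinct transitions sharing an input place
causally precede `x` and `y` respectively. -/
def SConflict (N : HLNet Color Var) (x y : N.Node) : Prop :=
  ∃ (b : N.Place) (t1 t2 : N.Trans), t1 ≠ t2 ∧
    (∃ v, (b, v) ∈ N.preFlow t1) ∧ (∃ v, (b, v) ∈ N.preFlow t2) ∧
    N.cle (Sum.inr t1) x ∧ N.cle (Sum.inr t2) y

/-- Ordinariness: at most one arc connects any two nodes. -/
def Ordinary (N : HLNet Color Var) : Prop :=
  (∀ (t : N.Trans) (b : N.Place), ((N.preFlow t).filter fun pv => pv.1 = b).card ≤ 1) ∧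
  (∀ (t : N.Trans) (b : N.Place), ((N.postFlow t).filter fun pv => pv.1 = b).card ≤ 1)

/-- A high-level occurrence net: an ordinary well-formed high-level Petri net
(places = conditions, transitions = events) such that no event is in structural
self-conflict, no node is its own causal predecessor, causality is well-founded,
and each condition either has no incoming arc and is marked with exactly one color
in all initial cuts, or has a unique incoming arc and is unmarked in all initial cuts. -/
def IsOccNet (O : HLNet Color Var) : Prop :=
  O.WellFormed ∧ O.Ordinary ∧
  (∀ e : O.Trans, ¬ O.SConflict (Sum.inr e) (Sum.inr e)) ∧
  (∀ x : O.Node, ¬ O.clt x x) ∧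
  WellFounded O.clt ∧
  (∀ b : O.Place,
    ((∀ (e : O.Trans) (v : Var), (b, v) ∉ O.postFlow e) ∧
      ∀ K ∈ O.init, (K.filter fun bc => bc.1 = b).card = 1) ∨
    ((∃ (e : O.Trans) (v : Var), (b, v) ∈ O.postFlow e ∧
        ∀ (e' : O.Trans) (v' : Var), (b, v') ∈ O.postFlow e' → e' = e ∧ v' = v) ∧
      ∀ K ∈ O.init, (K.filter fun bc => bc.1 = b).card = 0))

/-- `•b = (e(b), v(b))`: the unique input event and arc-variable of a condition,
or `none` for the `⊥`-conditions (the conditions marked in all initial cuts). -/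
def condPre (O : HLNet Color Var) (b : O.Place) : Option (O.Trans × Var) :=
  if h : ∃ ev : O.Trans × Var, (b, ev.2) ∈ O.postFlow ev.1 then some h.choose else none

/-- An assignment of colors to the indexed variables: the variables `v_e` for events `e`
(`Sum.inl (e, v)`), and the variables `v^b_⊥` for conditions `b` (`Sum.inr b`). -/
abbrev Assign (O : HLNet Color Var) : Type := ((O.Trans × Var) ⊕ O.Place) → Color

/-- The color placed on condition `b` under assignment `ι`:
the value of `v(b)_{e(b)}`, resp. `v^b_⊥`. -/
def valOf (O : HLNet Color Var) (ι : O.Assign) (b : O.Place) : Color :=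
  match O.condPre b with
  | none => ι (Sum.inr b)
  | some ev => ι (Sum.inl ev)

/-- `pred(⊥)`: `ι` chooses one of the initial cuts. -/
def predBot (O : HLNet Color Var) (ι : O.Assign) : Prop :=
  ∃ K ∈ O.init, ∀ (b : O.Place) (c : Color), (b, c) ∈ K → ι (Sum.inr b) = c

/-- `loc(e)`: the local predicate of an event. -/
def locPred (O : HLNet Color Var) (e : O.Trans) (ι : O.Assign) : Prop :=
  O.guard e (fun v => ι (Sum.inl (e, v))) ∧
  ∀ bv ∈ O.preFlow e, ι (Sum.inl (e, bv.2)) = O.valOf ι bv.1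

/-- `pred(e) = pred(⊥) ∧ ⋀_{e' ≤ e} loc(e')`. -/
def pred (O : HLNet Color Var) (e : O.Trans) (ι : O.Assign) : Prop :=
  O.predBot ι ∧ ∀ e', O.evLE e' e → O.locPred e' ι

/-- `pred(e(b))` for a condition `b` (which is `pred(⊥)` for `⊥`-conditions). -/
def condPred (O : HLNet Color Var) (b : O.Place) (ι : O.Assign) : Prop :=
  match O.condPre b with
  | none => O.predBot ι
  | some ev => O.pred ev.1 ι

/-- An instantiation of a set `C` of events: an assignment satisfying `pred(e)` for
every `e ∈ C ∪ {⊥}`. -/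
def IsInst (O : HLNet Color Var) (C : Set O.Trans) (ι : O.Assign) : Prop :=
  O.predBot ι ∧ ∀ e ∈ C, O.pred e ι

/-- A configuration: a causally closed set of events free of structural conflict
and of color conflict. -/
def IsConfig (O : HLNet Color Var) (C : Set O.Trans) : Prop :=
  (∀ e ∈ C, ∀ e', O.evLE e' e → e' ∈ C) ∧
  (∀ e ∈ C, ∀ e' ∈ C, ¬ O.SConflict (Sum.inr e) (Sum.inr e')) ∧
  ∃ ι, O.IsInst C ι

/-- A finite configuration. -/
def FinCfg (O : HLNet Color Var) (C : Set O.Trans) : Prop := O.IsConfig C ∧ C.Finite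

/-- The cone configuration `[e] = {e' : e' ≤ e}` of an event. -/
def cone (O : HLNet Color Var) (e : O.Trans) : Set O.Trans := {e' | O.evLE e' e}

/-- `B0`: the conditions marked in all initial cuts (those with `•b = (⊥, v^b)`). -/
def B0 (O : HLNet Color Var) : Set O.Place := {b | O.condPre b = none}

/-- `C→`: the conditions in the postsets of the events of `C`. -/
def postConds (O : HLNet Color Var) (C : Set O.Trans) : Set O.Place :=
  {b | ∃ e ∈ C, ∃ v, (b, v) ∈ O.postFlow e}

/-- `→C`: the conditions in the presets of the events of `C`. -/
def preConds (O : HLNet Color Var) (C : Set O.Trans) : Set O.Place :=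
  {b | ∃ e ∈ C, ∃ v, (b, v) ∈ O.preFlow e}

/-- `Cut(C) = (B0 ∪ C→) \ →C`. -/
def cut (O : HLNet Color Var) (C : Set O.Trans) : Set O.Place :=
  (O.B0 ∪ O.postConds C) \ O.preConds C

/-- `Cut(C, ι)` as a marking of the occurrence net (requires `Cut(C)` to be finite). -/
def cutMark (O : HLNet Color Var) {C : Set O.Trans} (hfin : (O.cut C).Finite)
    (ι : O.Assign) : O.Marking :=
  hfin.toFinset.val.map fun b => (b, O.valOf ι b)

/-- `Cut(C, ι) = {(b, ι(v(b)_{e(b)})) : b ∈ Cut(C)}` as a set. -/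
def cutSet (O : HLNet Color Var) (C : Set O.Trans) (ι : O.Assign) : Set (O.Place × Color) :=
  {bc | bc.1 ∈ O.cut C ∧ bc.2 = O.valOf ι bc.1}

/-- `Cuts(C) = {Cut(C,ι) : ι ∈ I(C)}`. -/
def cuts (O : HLNet Color Var) (C : Set O.Trans) : Set (Set (O.Place × Color)) :=
  {K | ∃ ι, O.IsInst C ι ∧ K = O.cutSet C ι}

/-- `Cuts(C)` as a set of markings of the occurrence net. -/
def cutMarks (O : HLNet Color Var) (C : Set O.Trans) : Set O.Marking :=
  {K | ∃ ι, O.IsInst C ι ∧ ∃ hfin : (O.cut C).Finite, K = O.cutMark hfin ι}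

/-- A homomorphism of high-level nets: maps places to places and transitions to
transitions, preserving guards and the presets and postsets of transitions. -/
structure Hom (O N : HLNet Color Var) where
  mapP : O.Place → N.Place
  mapT : O.Trans → N.Trans
  guard_iff : ∀ (e : O.Trans) (σ : Var → Color), O.guard e σ ↔ N.guard (mapT e) σ
  pre_eq : ∀ e : O.Trans, N.preFlow (mapT e) = (O.preFlow e).map fun bv => (mapP bv.1, bv.2)
  post_eq : ∀ e : O.Trans, N.postFlow (mapT e) = (O.postFlow e).map fun bv => (mapP bv.1, bv.2)

/-- The image of a marking under a homomorphism. -/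
def Hom.mapMarking {O N : HLNet Color Var} (φ : Hom O N) (M : O.Marking) : N.Marking :=
  M.map fun bc => (φ.mapP bc.1, bc.2)

/-- An initial homomorphism: it maps the initial markings onto the initial markings. -/
def Hom.Initial {O N : HLNet Color Var} (φ : Hom O N) : Prop :=
  φ.mapMarking '' O.init = N.init

/-- `Mark(C, ι)`: the marking of `N` represented by the cut of an instantiated
configuration. -/
def mark {O N : HLNet Color Var} (h : Hom O N) {C : Set O.Trans}
    (hfin : (O.cut C).Finite) (ι : O.Assign) : N.Marking :=
  hfin.toFinset.val.map fun b => (h.mapP b, O.valOf ι b)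

/-- `Marks(C) = {Mark(C,ι) : ι ∈ I(C)}`. -/
def marks {O N : HLNet Color Var} (h : Hom O N) (C : Set O.Trans) : Set N.Marking :=
  {M | ∃ ι, O.IsInst C ι ∧ ∃ hfin : (O.cut C).Finite, M = mark h hfin ι}

/-- `(O, h)` is a symbolic branching process of `N`: `O` is an occurrence net all of
whose event predicates are satisfiable, and `h` is an initial homomorphism that is
injective on events with the same preset. -/
def IsSBP {O N : HLNet Color Var} (h : Hom O N) : Prop :=
  O.IsOccNet ∧ h.Initial ∧ (∀ e : O.Trans, ∃ ι, O.pred e ι) ∧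
  ∀ e e' : O.Trans, O.preFlow e = O.preFlow e' → h.mapT e = h.mapT e' → e = e'

/-- `(O1, h1)` is a prefix of `(O2, h2)`: there is an injective initial homomorphism
`φ : O1 → O2` with `h2 ∘ φ = h1`. -/
def IsPrefix {O1 O2 N : HLNet Color Var} (h1 : Hom O1 N) (h2 : Hom O2 N) : Prop :=
  ∃ φ : Hom O1 O2, φ.Initial ∧ Function.Injective φ.mapP ∧ Function.Injective φ.mapT ∧
    (∀ b, h2.mapP (φ.mapP b) = h1.mapP b) ∧ ∀ e, h2.mapT (φ.mapT e) = h1.mapT e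

/-- `(O, h)` is the symbolic unfolding `Υ(N)` of `N`: the (unique up to isomorphism)
maximal symbolic branching process of `N`. -/
def IsUnfolding {O N : HLNet Color Var} (h : Hom O N) : Prop :=
  IsSBP h ∧ ∀ (O' : HLNet Color Var) (h' : Hom O' N), IsSBP h' → IsPrefix h' h

/-- The net `N` with its set of initial markings replaced by `I`. -/
def withInit (N : HLNet Color Var) (I : Set N.Marking) : HLNet Color Var :=
  { N with init := I }

/-- Restriction of a marking to a subset of the places. -/
def restrictMark (O : HLNet Color Var) (SP : Set O.Place) (M : O.Marking) :
    Multiset (↥SP × Color) :=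
  M.filterMap fun bc => if h : bc.1 ∈ SP then some (⟨bc.1, h⟩, bc.2) else none

/-- The subnet of `O` on the places `SP` and transitions `ST`, with initial markings `I`. -/
def restrict (O : HLNet Color Var) (SP : Set O.Place) (ST : Set O.Trans)
    (I : Set (Multiset (↥SP × Color))) : HLNet Color Var where
  Place := ↥SP
  Trans := ↥ST
  preFlow e := (O.preFlow e.1).filterMap fun bv =>
    if h : bv.1 ∈ SP then some (⟨bv.1, h⟩, bv.2) else none
  postFlow e := (O.postFlow e.1).filterMap fun bv =>
    if h : bv.1 ∈ SP then some (⟨bv.1, h⟩, bv.2) else none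
  guard e σ := O.guard e.1 σ
  init := I

/-- The predicate contributed by a node to a color conflict:
`pred(e)` for an event `e`, `pred(e(b))` for a condition `b`. -/
def nodePred (O : HLNet Color Var) (x : O.Node) (ι : O.Assign) : Prop :=
  match x with
  | Sum.inl b => O.condPred b ι
  | Sum.inr e => O.pred e ι

/-- The nodes of the future `↑C`: nodes not in `C ∪ →C`, not in structural conflict
with any event of `C`, and not in color conflict together with `C`. -/
def futureNode (O : HLNet Color Var) (C : Set O.Trans) (x : O.Node) : Prop :=
  (match x with
   | Sum.inl b => b ∉ O.preConds C
   | Sum.inr e => e ∉ C) ∧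
  (∀ e' ∈ C, ¬ O.SConflict (Sum.inr e') x) ∧
  ∃ ι, O.IsInst C ι ∧ O.nodePred x ι

def futurePlaces (O : HLNet Color Var) (C : Set O.Trans) : Set O.Place :=
  {b | O.futureNode C (Sum.inl b)}

def futureEvents (O : HLNet Color Var) (C : Set O.Trans) : Set O.Trans :=
  {e | O.futureNode C (Sum.inr e)}

/-- The underlying net of the future `↑C` of a configuration `C`, with the cuts of `C`
as initial cuts. -/
def future (O : HLNet Color Var) (C : Set O.Trans) : HLNet Color Var :=
  O.restrict (O.futurePlaces C) (O.futureEvents C)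
    (O.restrictMark (O.futurePlaces C) '' O.cutMarks C)

def futPVal (O : HLNet Color Var) (C : Set O.Trans) : (O.future C).Place → O.Place :=
  fun b => b.1

def futTVal (O : HLNet Color Var) (C : Set O.Trans) : (O.future C).Trans → O.Trans :=
  fun e => e.1

/-- The conditions of the occurrence net `O(C|D)`: `Cut(C) ∪ →D ∪ D→`. -/
def aroundPlaces (O : HLNet Color Var) (C D : Set O.Trans) : Set O.Place :=
  O.cut C ∪ O.preConds D ∪ O.postConds D

/-- The occurrence net `O(C|D)` "around `D` from `Cut(C)`", with initial cuts `Cuts(C)`. -/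
def around (O : HLNet Color Var) (C D : Set O.Trans) : HLNet Color Var :=
  O.restrict (O.aroundPlaces C D) D
    (O.restrictMark (O.aroundPlaces C D) '' O.cutMarks C)

def arPVal (O : HLNet Color Var) (C D : Set O.Trans) : (O.around C D).Place → O.Place :=
  fun b => b.1

def arTVal (O : HLNet Color Var) (C D : Set O.Trans) : (O.around C D).Trans → O.Trans :=
  fun e => e.1

/-- `D` is a suffix of `C`, i.e. `C ⊕ D` is defined: `C` and `D` are disjoint and
`C ∪ D` is a configuration. -/
def IsSuffix (O : HLNet Color Var) (C D : Set O.Trans) : Prop :=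
  Disjoint C D ∧ O.IsConfig (C ∪ D)

/-- `C⟦M⟧D`: some instantiation of `C ⊕ D`, restricted to the variables of `C ∪ {⊥}`,
yields the marking `M` for `C`. -/
def markRel {O N : HLNet Color Var} (h : Hom O N) (C : Set O.Trans) (M : N.Marking)
    (D : Set O.Trans) : Prop :=
  ∃ ι, O.IsInst (C ∪ D) ι ∧ ∃ hfin : (O.cut C).Finite, mark h hfin ι = M

/-- `φ` is a monomorphism `O(C1|D) → ↑C2` preserving the labeling and mapping
`Cut(C1)` onto `Cut(C2)`. -/
def IsCanonMono {O N : HLNet Color Var} (h : Hom O N) (C1 D C2 : Set O.Trans)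
    (φ : Hom (O.around C1 D) (O.future C2)) : Prop :=
  Function.Injective φ.mapP ∧ Function.Injective φ.mapT ∧
  (∀ b, h.mapP (O.futPVal C2 (φ.mapP b)) = h.mapP (O.arPVal C1 D b)) ∧
  (∀ e, h.mapT (O.futTVal C2 (φ.mapT e)) = h.mapT (O.arTVal C1 D e)) ∧
  (fun b => O.futPVal C2 (φ.mapP b)) '' {b | O.arPVal C1 D b ∈ O.cut C1} = O.cut C2

/-- `φ(D)`: the image of the events `D` of `O(C1|D)` under `φ`, as a set of events of `O`. -/
def monoImageD {O : HLNet Color Var} (C1 D C2 : Set O.Trans)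
    (φ : Hom (O.around C1 D) (O.future C2)) : Set O.Trans :=
  {e | ∃ d, O.futTVal C2 (φ.mapT d) = e}

/-- An adequate order on the finite configurations of a symbolic branching process
`(O, h)`: a well-founded strict partial order refining set inclusion and preserved
by finite extensions (via the canonical monomorphism between the futures). -/
def IsAdequate {O N : HLNet Color Var} (h : Hom O N)
    (r : Set O.Trans → Set O.Trans → Prop) : Prop :=
  (∀ C, O.FinCfg C → ¬ r C C) ∧
  (∀ C1 C2 C3, O.FinCfg C1 → O.FinCfg C2 → O.FinCfg C3 → r C1 C2 → r C2 C3 → r C1 C3) ∧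
  WellFounded (fun a b : {C : Set O.Trans // O.FinCfg C} => r a.1 b.1) ∧
  (∀ C1 C2, O.FinCfg C1 → O.FinCfg C2 → C1 ⊂ C2 → r C1 C2) ∧
  (∀ C1 C2 D M, O.FinCfg C1 → O.FinCfg C2 → O.IsSuffix C1 D → D.Finite →
    M ∈ marks h C1 → M ∈ marks h C2 → markRel h C1 M D →
    ∀ φ : Hom (O.around C1 D) (O.future C2), IsCanonMono h C1 D C2 φ →
      r C1 C2 → r (C1 ∪ D) (C2 ∪ monoImageD C1 D C2 φ))

/-- A cut-off event: every marking of its cone configuration is represented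
by the cone configuration of a `≺`-smaller event. -/
def IsCutoff {O N : HLNet Color Var} (h : Hom O N)
    (r : Set O.Trans → Set O.Trans → Prop) (e : O.Trans) : Prop :=
  ∀ M ∈ marks h (O.cone e), ∃ e', r (O.cone e') (O.cone e) ∧ M ∈ marks h (O.cone e')

/-- A cut-off* event: every marking of its cone configuration is represented
by some `≺`-smaller finite configuration. -/
def IsCutoffStar {O N : HLNet Color Var} (h : Hom O N)
    (r : Set O.Trans → Set O.Trans → Prop) (e : O.Trans) : Prop :=
  ∀ M ∈ marks h (O.cone e), ∃ C, O.FinCfg C ∧ r C (O.cone e) ∧ M ∈ marks h C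

/-- The events of the prefix `Fin`: events whose cone contains no cut-off event other
than possibly the event itself. -/
def finEvents {O N : HLNet Color Var} (h : Hom O N)
    (r : Set O.Trans → Set O.Trans → Prop) : Set O.Trans :=
  {e | ∀ e' ∈ O.cone e, e' ≠ e → ¬ IsCutoff h r e'}

/-- The conditions of the prefix `Fin`: the conditions of `B0` and those in the
postsets of the events of `Fin`. -/
def finConds {O N : HLNet Color Var} (h : Hom O N)
    (r : Set O.Trans → Set O.Trans → Prop) : Set O.Place :=
  O.B0 ∪ {b | ∃ e ∈ finEvents h r, ∃ v, (b, v) ∈ O.postFlow e}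

/-- The events of the prefix `Fin` for the cut-off* criterion. -/
def finEventsStar {O N : HLNet Color Var} (h : Hom O N)
    (r : Set O.Trans → Set O.Trans → Prop) : Set O.Trans :=
  {e | ∀ e' ∈ O.cone e, e' ≠ e → ¬ IsCutoffStar h r e'}

/-- The conditions of the prefix `Fin` for the cut-off* criterion. -/
def finCondsStar {O N : HLNet Color Var} (h : Hom O N)
    (r : Set O.Trans → Set O.Trans → Prop) : Set O.Place :=
  O.B0 ∪ {b | ∃ e ∈ finEventsStar h r, ∃ v, (b, v) ∈ O.postFlow e}

/-- Completeness of the sub-branching-process of `(O,h)` on the events `E'`: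
every reachable marking `M` of `N` is `Mark(C,ι)` for a configuration `C ⊆ E'` and
an instantiation `ι ∈ I(C)` such that moreover every transition/mode firable from `M`
is matched by an event of `E'` firable from `Cut(C,ι)`. -/
def CompleteSub {O N : HLNet Color Var} (h : Hom O N) (E' : Set O.Trans) : Prop :=
  ∀ M, N.Reach M → ∃ C, O.IsConfig C ∧ C ⊆ E' ∧ ∃ ι, O.IsInst C ι ∧
    ∃ hfin : (O.cut C).Finite, M = mark h hfin ι ∧
      ∀ (t : N.Trans) (σ : Var → Color), N.fires M t σ →
        ∃ e ∈ E', h.mapT e = t ∧ O.fires (O.cutMark hfin ι) e σ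

/-- Completeness of the branching process `(O, h)`. -/
def Complete {O N : HLNet Color Var} (h : Hom O N) : Prop := CompleteSub h Set.univ

/-- The class `Nf`: finite safe high-level Petri nets with decidable guards and
finitely many reachable markings. -/
def InNf (N : HLNet Color Var) : Prop :=
  N.NetFinite ∧ N.WellFormed ∧ N.Safe ∧ N.DecidableGuards ∧ {M | N.Reach M}.Finite

/-- The class `Nsc` of symbolically compact nets: finite safe high-level Petri nets
with decidable guards admitting a bound on the number of transition firings needed
to reach every reachable marking. -/
def InNsc (N : HLNet Color Var) : Prop :=
  N.NetFinite ∧ N.WellFormed ∧ N.Safe ∧ N.DecidableGuards ∧ ∃ n, N.BoundedReach n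

/-- The modes of a transition. -/
def Mode (N : HLNet Color Var) (t : N.Trans) : Type := {σ : Var → Color // N.guard t σ}

/-- The expansion `Exp(N)`: the P/T Petri net (a high-level net over the trivial sets
of colors and variables) with places `p.c` and transitions `t.σ`. -/
def expand (N : HLNet Color Var) : HLNet Unit Unit where
  Place := N.Place × Color
  Trans := (t : N.Trans) × N.Mode t
  preFlow tσ := (N.preMark tσ.1 tσ.2.1).map fun pc => (pc, ())
  postFlow tσ := (N.postMark tσ.1 tσ.2.1).map fun pc => (pc, ())
  guard _ _ := True
  init := (fun M : N.Marking => M.map fun pc => (pc, ())) '' N.init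

def expPlaceBase (N : HLNet Color Var) : N.expand.Place → N.Place := fun pc => pc.1
def expPlaceColor (N : HLNet Color Var) : N.expand.Place → Color := fun pc => pc.2
def expTransBase (N : HLNet Color Var) : N.expand.Trans → N.Trans := fun tσ => tσ.1
def expTransMode (N : HLNet Color Var) (tσ : N.expand.Trans) : Var → Color := tσ.2.1

/-- The constraint `constr(B')` on a co-set `B'` of conditions, evaluated on an
assignment `a` of colors to the labels `π(B')` (predb(b) for all `b ∈ B'`,
with all bound indexed variables existentially quantified at once). -/
def constrSat {O N : HLNet Color Var} (h : Hom O N) (B' : Set O.Place)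
    (a : N.Place → Color) : Prop :=
  ∃ ι : O.Assign, ∀ b ∈ B', O.condPred b ι ∧ a (h.mapP b) = O.valOf ι b

/-- `φ(E')`: the multiset of the transition labels of a finite set of events. -/
def labelMS {O N : HLNet Color Var} (h : Hom O N) (S : Set O.Trans) : Multiset N.Trans :=
  if hfin : S.Finite then hfin.toFinset.val.map h.mapT else 0

/-- Lexicographic comparison of the `≪`-sorted sequences of two multisets. -/
def msLex {α : Type} (lo : LinearOrder α) (s1 s2 : Multiset α) : Prop :=
  letI := lo
  List.Lex (· < ·) (s1.sort (· ≤ ·)) (s2.sort (· ≤ ·))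

/-- `Min(S)`: the causally minimal events of `S`. -/
def minOf (O : HLNet Color Var) (S : Set O.Trans) : Set O.Trans :=
  {e | e ∈ S ∧ ∀ e' ∈ S, ¬ O.evLT e' e}

/-- What remains of `C` after removing the first `n` blocks of its Foata normal form. -/
def foataResidual (O : HLNet Color Var) (C : Set O.Trans) : ℕ → Set O.Trans
  | 0 => C
  | n + 1 => foataResidual O C n \ O.minOf (foataResidual O C n)

/-- The `n`-th block of the Foata normal form of `C`. -/
def foataBlock (O : HLNet Color Var) (C : Set O.Trans) (n : ℕ) : Set O.Trans :=
  O.minOf (O.foataResidual C n)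

/-- `FC1 ≪ FC2`: comparison of Foata normal forms. -/
def foataLex {O N : HLNet Color Var} (h : Hom O N) (lo : LinearOrder N.Trans)
    (C1 C2 : Set O.Trans) : Prop :=
  ∃ i : ℕ, (∀ j < i, labelMS h (O.foataBlock C1 j) = labelMS h (O.foataBlock C2 j)) ∧
    msLex lo (labelMS h (O.foataBlock C1 i)) (labelMS h (O.foataBlock C2 i))

/-- McMillan's order `≺_M`: comparison by size. -/
def rM {O : HLNet Color Var} (C1 C2 : Set O.Trans) : Prop := C1.ncard < C2.ncard

/-- The order `≺_E`: by size, then lexicographically on sorted label sequences. -/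
def rE {O N : HLNet Color Var} (h : Hom O N) (lo : LinearOrder N.Trans)
    (C1 C2 : Set O.Trans) : Prop :=
  C1.ncard < C2.ncard ∨
    (C1.ncard = C2.ncard ∧ msLex lo (labelMS h C1) (labelMS h C2))

/-- The total order `≺_F`: by size, then lexicographically on sorted label sequences,
then by Foata normal forms. -/
def rF {O N : HLNet Color Var} (h : Hom O N) (lo : LinearOrder N.Trans)
    (C1 C2 : Set O.Trans) : Prop :=
  C1.ncard < C2.ncard ∨
    (C1.ncard = C2.ncard ∧ msLex lo (labelMS h C1) (labelMS h C2)) ∨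
    (labelMS h C1 = labelMS h C2 ∧ foataLex h lo C1 C2)

end HLNet

theorem Multiset.sub_self_add {α : Type} {_ : DecidableEq α} (s t : Multiset α) :
    s - s + t = t := by
  rw [tsub_self, zero_add]

theorem Multiset.card_filter_singleton_le {α : Type} (a : α) (p : α → Prop)
    {_ : DecidablePred p} : (({a} : Multiset α).filter p).card ≤ 1 :=
  (Multiset.card_le_card (Multiset.filter_le _ _)).trans_eq (Multiset.card_singleton _)

theorem Multiset.card_filter_singleton {α : Type} (a : α) (p : α → Prop)
    {_ : DecidablePred p} : (({a} : Multiset α).filter p).card = if p a then 1 else 0 := by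
  rw [Multiset.filter_singleton]
  split_ifs <;> rfl

theorem Multiset.card_filter_map_some_le {ι β : Type} [Fintype ι] (g : ι → β) (p : Option ι)
    {inst : DecidablePred fun x : Option ι × β => x.1 = p} :
    (((Finset.univ : Finset ι).val.map fun i => (some i, g i)).filter
      fun x => x.1 = p).card ≤ 1 := by
  rw [Multiset.filter_map, Multiset.card_map]
  refine (Finset.card_le_one
    (s := @Finset.filter ι (fun i => some i = p) (fun i => inst (some i, g i)) Finset.univ)).2 ?_
  intro i hi j hj
  simp only [Finset.mem_filter, Finset.mem_univ, true_and] at hi hj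
  exact Option.some_injective _ (hi.trans hj.symm)

namespace HLNet

/-- The net with a single transition that consumes the color `0` from its only initially
marked place `none` and puts an arbitrary color on each of the places `some i`. -/
abbrev scatterNet (n m : ℕ) : HLNet (Fin (m + 1)) (Option (Fin n)) where
  Place := Option (Fin n)
  Trans := Unit
  preFlow _ := {(none, none)}
  postFlow _ := (Finset.univ : Finset (Fin n)).val.map fun i => (some i, some i)
  guard _ _ := True
  init := {{(none, 0)}}

namespace scatterNet

variable {n m : ℕ}

theorem not_mem_postFlow_none (e : (scatterNet n m).Trans) (v : Option (Fin n)) :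
    ((none, v) : Option (Fin n) × Option (Fin n)) ∉ (scatterNet n m).postFlow e := by
  simp [scatterNet]

theorem mem_postFlow_some {e : (scatterNet n m).Trans} {i : Fin n} {v : Option (Fin n)} :
    ((some i, v) : Option (Fin n) × Option (Fin n)) ∈ (scatterNet n m).postFlow e ↔
      v = some i := by
  simp [scatterNet, eq_comm]

theorem mem_preFlow {e : (scatterNet n m).Trans} {b v : Option (Fin n)} :
    ((b, v) : Option (Fin n) × Option (Fin n)) ∈ (scatterNet n m).preFlow e ↔
      b = none ∧ v = none := by
  simp [scatterNet]

theorem preMark_eq (t : (scatterNet n m).Trans) (σ : Option (Fin n) → Fin (m + 1)) :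
    (scatterNet n m).preMark t σ = {((none, σ none) : Option (Fin n) × Fin (m + 1))} := by
  simp [preMark, scatterNet]

theorem postMark_eq (t : (scatterNet n m).Trans) (σ : Option (Fin n) → Fin (m + 1)) :
    (scatterNet n m).postMark t σ =
      (Finset.univ : Finset (Fin n)).val.map fun i => (some i, σ (some i)) := by
  rw [postMark, Multiset.map_map]
  rfl

theorem eq_of_reach {M : (scatterNet n m).Marking} (hM : (scatterNet n m).Reach M) :
    M = {((none, 0) : Option (Fin n) × Fin (m + 1))} ∨
      ∃ σ : Option (Fin n) → Fin (m + 1), σ none = 0 ∧ M = (scatterNet n m).postMark () σ := by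
  induction hM with
  | init h => exact Or.inl h
  | @step M t σ M' _ h ih =>
    obtain ⟨⟨_, hle⟩, rfl⟩ := h
    have hmem := Multiset.mem_of_le hle
      (by rw [preMark_eq]; exact Multiset.mem_singleton_self _)
    rcases ih with rfl | ⟨τ, _, rfl⟩
    · right
      have hσ : σ none = 0 := congrArg Prod.snd (Multiset.mem_singleton.1 hmem)
      refine ⟨σ, hσ, ?_⟩
      rw [preMark_eq, hσ, Multiset.sub_self_add]
    · rw [postMark_eq] at hmem
      simp at hmem

theorem wellFormed : (scatterNet n m).WellFormed := by
  refine ⟨⟨_, rfl⟩, ?_⟩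
  rintro M rfl M' rfl
  rfl

theorem netFinite : (scatterNet n m).NetFinite :=
  ⟨inferInstanceAs (Finite (Option (Fin n))), inferInstanceAs (Finite Unit)⟩

theorem inNf : (scatterNet n m).InNf := by
  refine ⟨netFinite, wellFormed, ?_, fun t σ => ⟨Classical.dec _⟩, ?_⟩
  · intro M hM p
    rcases eq_of_reach hM with rfl | ⟨σ, _, rfl⟩
    · exact Multiset.card_filter_singleton_le _ _
    · rw [postMark_eq]
      exact Multiset.card_filter_map_some_le _ p
  · refine ((Set.finite_singleton ({(none, 0)} : (scatterNet n m).Marking)).union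
      (Set.finite_range fun σ : Option (Fin n) → Fin (m + 1) =>
        (scatterNet n m).postMark () σ)).subset ?_
    intro M hM
    rcases eq_of_reach hM with rfl | ⟨σ, _, rfl⟩
    · exact Or.inl rfl
    · exact Or.inr ⟨σ, rfl⟩

/-- A rank that increases along every arc. -/
def rank : (scatterNet n m).Node → ℕ
  | Sum.inl none => 0
  | Sum.inr _ => 1
  | Sum.inl (some _) => 2

theorem rank_lt_of_arc {x y : (scatterNet n m).Node} (h : (scatterNet n m).arc x y) :
    rank x < rank y := by
  rcases x with (_ | i) | t <;> rcases y with (_ | j) | t'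
  all_goals first | exact h.elim | skip
  · simp [rank]
  · obtain ⟨v, hv⟩ := h
    exact absurd (mem_preFlow.1 hv).1 (by simp)
  · obtain ⟨v, hv⟩ := h
    exact absurd hv (not_mem_postFlow_none _ _)
  · simp [rank]

theorem rank_lt_of_clt {x y : (scatterNet n m).Node} (h : (scatterNet n m).clt x y) :
    rank x < rank y := by
  induction h with
  | single h => exact rank_lt_of_arc h
  | tail _ h ih => exact ih.trans (rank_lt_of_arc h)

theorem isOccNet : (scatterNet n m).IsOccNet := by
  refine ⟨wellFormed, ⟨fun t b => ?_, fun t b => ?_⟩, ?_, ?_, ?_, ?_⟩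
  · exact Multiset.card_filter_singleton_le _ _
  · exact Multiset.card_filter_map_some_le _ b
  · rintro e ⟨b, t₁, t₂, hne, -⟩
    exact hne rfl
  · exact fun x h => lt_irrefl _ (rank_lt_of_clt h)
  · exact Subrelation.wf rank_lt_of_clt (InvImage.wf rank Nat.lt_wfRel.wf)
  · rintro (_ | i)
    · refine Or.inl ⟨not_mem_postFlow_none, ?_⟩
      rintro K rfl
      exact (Multiset.card_filter_singleton _ _).trans (if_pos rfl)
    · refine Or.inr ⟨⟨(), some i, mem_postFlow_some.2 rfl, fun e' v' h => ?_⟩, ?_⟩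
      · exact ⟨rfl, mem_postFlow_some.1 h⟩
      · rintro K rfl
        exact (Multiset.card_filter_singleton _ _).trans (if_neg (Option.some_ne_none i).symm)

theorem condPre_none :
    (scatterNet n m).condPre (none : Option (Fin n)) = none :=
  dif_neg fun ⟨_, h⟩ => not_mem_postFlow_none _ _ h

theorem condPre_some (i : Fin n) :
    (scatterNet n m).condPre (some i : Option (Fin n)) = some ((), some i) := by
  have h : ∃ ev : (scatterNet n m).Trans × Option (Fin n),
      ((some i, ev.2) : Option (Fin n) × Option (Fin n)) ∈ (scatterNet n m).postFlow ev.1 :=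
    ⟨((), some i), mem_postFlow_some.2 rfl⟩
  exact (dif_pos h).trans
    (congrArg some (Prod.ext rfl (mem_postFlow_some.1 h.choose_spec)))

/-- The assignment that gives the variables of the event the values of `σ`. -/
def assign (σ : Option (Fin n) → Fin (m + 1)) : (scatterNet n m).Assign
  | Sum.inl ev => σ ev.2
  | Sum.inr _ => 0

theorem valOf_assign_none (σ : Option (Fin n) → Fin (m + 1)) :
    (scatterNet n m).valOf (assign σ) (none : Option (Fin n)) = 0 := by
  rw [valOf, condPre_none]
  rfl

theorem valOf_assign_some (σ : Option (Fin n) → Fin (m + 1)) (i : Fin n) :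
    (scatterNet n m).valOf (assign σ) (some i : Option (Fin n)) = σ (some i) := by
  rw [valOf, condPre_some]
  rfl

theorem predBot_assign (σ : Option (Fin n) → Fin (m + 1)) :
    (scatterNet n m).predBot (assign σ) :=
  ⟨_, rfl, fun _ _ h => (congrArg Prod.snd (Multiset.mem_singleton.1 h)).symm⟩

theorem pred_assign {σ : Option (Fin n) → Fin (m + 1)} (hσ : σ none = 0)
    (e : (scatterNet n m).Trans) : (scatterNet n m).pred e (assign σ) := by
  refine ⟨predBot_assign σ, fun e' _ => ⟨trivial, ?_⟩⟩
  rintro ⟨b, v⟩ h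
  obtain ⟨rfl, rfl⟩ := mem_preFlow.1 h
  exact hσ.trans (valOf_assign_none σ).symm

theorem cut_empty : (scatterNet n m).cut ∅ = ({none} : Set (Option (Fin n))) := by
  ext (_ | i)
  · simp [cut, B0, postConds, preConds, condPre_none]
  · simp [cut, B0, postConds, preConds, condPre_some]

theorem cut_univ :
    (scatterNet n m).cut Set.univ = Set.range (some : Fin n → Option (Fin n)) := by
  ext (_ | i)
  · refine ⟨fun h => (h.2 ⟨(), trivial, none, ?_⟩).elim, fun ⟨_, h⟩ => by cases h⟩
    exact (mem_preFlow (e := ())).2 ⟨rfl, rfl⟩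
  · refine ⟨fun _ => ⟨i, rfl⟩, fun _ => ⟨Or.inr ⟨(), trivial, some i, mem_postFlow_some.2 rfl⟩, ?_⟩⟩
    rintro ⟨e, _, v, h⟩
    exact Option.some_ne_none i (mem_preFlow.1 h).1

theorem isConfig_of_inst {C : Set (scatterNet n m).Trans} {ι : (scatterNet n m).Assign}
    (hC : C = ∅ ∨ C = Set.univ) (hι : (scatterNet n m).IsInst C ι) :
    (scatterNet n m).IsConfig C := by
  refine ⟨?_, fun _ _ _ _ ⟨_, _, _, hne, _⟩ => hne rfl, ι, hι⟩
  rcases hC with rfl | rfl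
  · exact fun _ h => h.elim
  · exact fun _ _ _ _ => trivial

/-- The identity homomorphism. -/
def idHom (N : HLNet (Fin (m + 1)) (Option (Fin n))) : Hom N N where
  mapP := id
  mapT := id
  guard_iff _ _ := Iff.rfl
  pre_eq _ := (Multiset.map_id' _).symm
  post_eq _ := (Multiset.map_id' _).symm

theorem isSBP_idHom : IsSBP (idHom (scatterNet n m)) := by
  refine ⟨isOccNet, ?_, fun e => ⟨_, pred_assign (σ := fun _ => 0) rfl e⟩, fun _ _ _ _ => rfl⟩
  have : (idHom (scatterNet n m)).mapMarking = id := funext fun M => Multiset.map_id' M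
  rw [Hom.Initial, this, Set.image_id]

theorem complete_idHom : Complete (idHom (scatterNet n m)) := by
  suffices key : ∀ M, (scatterNet n m).Reach M →
      ∃ C : Set (scatterNet n m).Trans, (C = ∅ ∨ C = Set.univ) ∧
        ∃ ι, (scatterNet n m).IsInst C ι ∧ ∃ hfin : ((scatterNet n m).cut C).Finite,
          M = mark (idHom (scatterNet n m)) hfin ι by
    intro M hM
    obtain ⟨C, hC, ι, hι, hfin, h⟩ := key M hM
    refine ⟨C, isConfig_of_inst hC hι, Set.subset_univ _, ι, hι, hfin, h, fun t σ ht => ?_⟩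
    exact ⟨t, trivial, rfl, ht.1, ht.2.trans_eq h⟩
  intro M hM
  rcases eq_of_reach hM with rfl | ⟨σ, hσ, rfl⟩
  · have hfin : ((scatterNet n m).cut ∅).Finite := cut_empty ▸ Set.finite_singleton _
    refine ⟨∅, Or.inl rfl, assign fun _ => 0, ⟨predBot_assign _, fun _ h => h.elim⟩, hfin, ?_⟩
    have hcut : hfin.toFinset = ({none} : Finset (Option (Fin n))) := by
      ext b
      rw [Set.Finite.mem_toFinset, cut_empty, Set.mem_singleton_iff, Finset.mem_singleton]
    rw [mark, hcut, Finset.singleton_val, Multiset.map_singleton, valOf_assign_none]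
    rfl
  · have hfin : ((scatterNet n m).cut Set.univ).Finite := cut_univ ▸ Set.finite_range _
    refine ⟨Set.univ, Or.inr rfl, assign σ, ⟨predBot_assign _, fun e _ => pred_assign hσ e⟩,
      hfin, ?_⟩
    have hcut : hfin.toFinset = (Finset.univ : Finset (Fin n)).map Function.Embedding.some := by
      ext b
      rw [Set.Finite.mem_toFinset, cut_univ]
      simp
    rw [mark, hcut, Finset.map_val, Multiset.map_map, postMark_eq]
    exact Multiset.map_congr rfl fun i _ => Prod.ext rfl (valOf_assign_some σ i).symm

/-- The transition of the expansion in which `f` gives the produced colors. -/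
def expandTrans (f : Fin n → Fin (m + 1)) : (scatterNet n m).expand.Trans :=
  ⟨(), fun v => v.elim 0 f, trivial⟩

theorem expandTrans_injective : Function.Injective (expandTrans (n := n) (m := m)) := by
  intro f g h
  funext i
  exact congrFun (congrArg (fun t => (scatterNet n m).expTransMode t) h) (some i)

theorem pow_le_card_trans {O : HLNet Unit Unit} {h : Hom O (scatterNet n m).expand}
    (hc : Complete h) [Finite O.Trans] : (m + 1) ^ n ≤ Nat.card O.Trans := by
  obtain ⟨_, -, -, ι, -, hfin, -, hev⟩ := hc _ (Reach.init ⟨_, rfl, rfl⟩)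
  have hex (f : Fin n → Fin (m + 1)) : ∃ e, h.mapT e = expandTrans f := by
    obtain ⟨e, -, he, -⟩ := hev (expandTrans f) (fun _ => ()) ⟨trivial, le_of_eq rfl⟩
    exact ⟨e, he⟩
  choose ev hev' using hex
  have hinj : Function.Injective ev := fun f g hfg =>
    expandTrans_injective ((hev' f).symm.trans ((congrArg h.mapT hfg).trans (hev' g)))
  simpa using Nat.card_le_card_of_injective ev hinj

end scatterNet

end HLNet

/-- For every `n ∈ ℕ` there is a family `(N_m^n)_{m ≥ 1}` of high-level
Petri nets in the class `Nf`, where `N_m^n` has color set `{0,…,m}`, such that: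
(i) there is a complete finite prefix of the symbolic unfolding `Υ(N_m^n)` whose number
of nodes is the same for every `m`; and (ii) every complete prefix of the unfolding of
the expansion `Exp(N_m^n)` has more than `m^n` nodes. -/
theorem exists_family_small_symbolic_prefix_large_expansion_prefix :
    ∀ n : ℕ, ∃ (Var : Type) (Net : (m : ℕ) → HLNet (Fin (m + 1)) Var),
      (∀ m : ℕ, 1 ≤ m → (Net m).InNf) ∧
      (∃ k : ℕ, ∀ m : ℕ, 1 ≤ m →
        ∃ (O : HLNet (Fin (m + 1)) Var) (h : HLNet.Hom O (Net m)),
          HLNet.IsSBP h ∧ HLNet.Complete h ∧ O.NetFinite ∧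
          Nat.card O.Place + Nat.card O.Trans = k) ∧
      (∀ m : ℕ, 1 ≤ m →
        ∀ (O2 : HLNet Unit Unit) (h2 : HLNet.Hom O2 (Net m).expand),
          HLNet.IsSBP h2 → HLNet.Complete h2 → O2.NetFinite →
            m ^ n < Nat.card O2.Place + Nat.card O2.Trans) := by
  intro n
  refine ⟨Option (Fin (n + 1)), HLNet.scatterNet (n + 1), fun m _ => HLNet.scatterNet.inNf,
    ⟨Nat.card (Option (Fin (n + 1))) + Nat.card Unit, fun m _ =>
      ⟨_, _, HLNet.scatterNet.isSBP_idHom, HLNet.scatterNet.complete_idHom,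
        HLNet.scatterNet.netFinite, rfl⟩⟩, ?_⟩
  intro m _ O h _ hc hfin
  have := hfin.2
  calc m ^ n < (m + 1) ^ (n + 1) :=
        (Nat.pow_le_pow_left m.le_succ n).trans_lt (Nat.pow_lt_pow_right (by omega) n.lt_succ_self)
    _ ≤ Nat.card O.Trans := HLNet.scatterNet.pow_le_card_trans hc
    _ ≤ _ := Nat.le_add_left _ _
end
end

section
/- For a finite high-level Petri net N = (𝔑, ℳ0) there exists a finite and complete prefix of the symbolic unfolding Υ(N) if and only if there exists a bound n ∈ ℕ such that every marking in R(N) is reachable from a marking in ℳ0 by firing at most n transitions. -/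
/-
Core formalization of high-level Petri nets, symbolic unfoldings,
branching processes, configurations, adequate orders, cut-off events,
expansions and constraints, following Würdemann–Chatain–Haar–Panneke,
"Taking Complete Finite Prefixes To High Level, Symbolically".
-/

noncomputable section
open scoped Classical

namespace HLNet

section Basic

variable {Color Var : Type} {O N : HLNet Color Var}

/-- Every condition has at most one incoming arc. -/
def UniqueProducer (O : HLNet Color Var) : Prop :=
  ∀ ⦃b e v e' v'⦄, (b, v) ∈ O.postFlow e → (b, v') ∈ O.postFlow e' → e' = e ∧ v' = v

/-- A set of events that contains all causal predecessors of its members. -/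
def CausallyClosed (O : HLNet Color Var) (C : Set O.Trans) : Prop :=
  ∀ e ∈ C, ∀ e', O.evLE e' e → e' ∈ C

/-- A set of events without structural conflicts. -/
def ConflictFree (O : HLNet Color Var) (C : Set O.Trans) : Prop :=
  ∀ e ∈ C, ∀ e' ∈ C, ¬ O.SConflict (Sum.inr e) (Sum.inr e')

theorem card_filter_fst_eq_count {α β : Type} (s : Multiset (α × β)) (a : α) :
    (s.filter fun x => x.1 = a).card = (s.map Prod.fst).count a := by
  rw [Multiset.count_map]
  congr 1
  exact Multiset.filter_congr fun x _ => eq_comm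

theorem nodup_map_fst_iff {α β : Type} (s : Multiset (α × β)) :
    (s.map Prod.fst).Nodup ↔ ∀ a, (s.filter fun x => x.1 = a).card ≤ 1 := by
  simp only [card_filter_fst_eq_count, Multiset.nodup_iff_count_le_one]

theorem IsOccNet.uniqueProducer (hO : O.IsOccNet) : O.UniqueProducer := by
  intro b e v e' v' h h'
  rcases hO.2.2.2.2.2 b with ⟨hb, -⟩ | ⟨⟨e₁, v₁, -, hu⟩, -⟩
  · exact absurd h (hb _ _)
  · obtain ⟨rfl, rfl⟩ := hu _ _ h
    exact hu _ _ h'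

theorem IsOccNet.nodup_pre (hO : O.IsOccNet) (e : O.Trans) :
    ((O.preFlow e).map Prod.fst).Nodup :=
  (nodup_map_fst_iff _).2 (hO.2.1.1 e)

theorem IsOccNet.nodup_post (hO : O.IsOccNet) (e : O.Trans) :
    ((O.postFlow e).map Prod.fst).Nodup :=
  (nodup_map_fst_iff _).2 (hO.2.1.2 e)

theorem IsOccNet.mem_init_count (hO : O.IsOccNet) {K : O.Marking} (hK : K ∈ O.init)
    (b : O.Place) : (K.map Prod.fst).count b = if b ∈ O.B0 then 1 else 0 := by
  rw [← card_filter_fst_eq_count]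
  rcases hO.2.2.2.2.2 b with ⟨hb, h1⟩ | ⟨⟨e, v, hb, -⟩, h0⟩
  · rw [if_pos, h1 K hK]
    simp [B0, condPre, hb]
  · rw [if_neg, h0 K hK]
    simp only [B0, condPre, Set.mem_ofPred_eq]
    rw [dif_pos ⟨(e, v), hb⟩]
    simp

theorem condPre_eq_none_iff {b : O.Place} :
    O.condPre b = none ↔ ∀ e v, (b, v) ∉ O.postFlow e := by
  unfold condPre
  split_ifs with h
  · obtain ⟨ev, hev⟩ := h
    simp only [false_iff, not_forall, not_not]
    exact ⟨_, _, hev⟩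
  · simp only [true_iff]
    exact fun e v hv => h ⟨(e, v), hv⟩

theorem mem_postFlow_of_condPre {b : O.Place} {ev : O.Trans × Var}
    (h : O.condPre b = some ev) : (b, ev.2) ∈ O.postFlow ev.1 := by
  unfold condPre at h
  split_ifs at h with h'
  cases h
  exact h'.choose_spec

theorem UniqueProducer.condPre_eq_some (hU : O.UniqueProducer) {b : O.Place} {e : O.Trans}
    {v : Var} (h : (b, v) ∈ O.postFlow e) : O.condPre b = some (e, v) := by
  rcases hc : O.condPre b with - | ev
  · exact absurd h (condPre_eq_none_iff.1 hc e v)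
  · obtain ⟨h1, h2⟩ := hU h (mem_postFlow_of_condPre hc)
    rw [← h1, ← h2]

theorem valOf_of_none {b : O.Place} (h : O.condPre b = none) (ι : O.Assign) :
    O.valOf ι b = ι (Sum.inr b) := by
  simp [valOf, h]

theorem valOf_of_some {b : O.Place} {ev : O.Trans × Var} (h : O.condPre b = some ev)
    (ι : O.Assign) : O.valOf ι b = ι (Sum.inl ev) := by
  simp [valOf, h]

theorem exists_producer_of_cle {e' : O.Trans} {b : O.Place}
    (h : O.cle (Sum.inr e') (Sum.inl b)) : ∃ e v, (b, v) ∈ O.postFlow e ∧ O.evLE e' e := by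
  rcases Relation.ReflTransGen.cases_tail h with h | ⟨z, hz, hzb⟩
  · cases h
  · rcases z with b' | e
    · exact hzb.elim
    · obtain ⟨v, hv⟩ := hzb
      exact ⟨e, v, hv, hz⟩

theorem evLE_cases {e' e : O.Trans} (h : O.evLE e' e) :
    e' = e ∨ ∃ e'' b v v', (b, v) ∈ O.preFlow e ∧ (b, v') ∈ O.postFlow e'' ∧ O.evLE e' e'' := by
  rcases Relation.ReflTransGen.cases_tail h with h | ⟨z, hz, hze⟩
  · cases h
    exact Or.inl rfl
  · rcases z with b | e₁
    · obtain ⟨v, hv⟩ := hze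
      obtain ⟨e'', v', h1, h2⟩ := exists_producer_of_cle hz
      exact Or.inr ⟨e'', b, v, v', hv, h1, h2⟩
    · exact hze.elim

theorem clt_of_post_pre {e e' : O.Trans} {b : O.Place} {v v' : Var}
    (h : (b, v) ∈ O.postFlow e) (h' : (b, v') ∈ O.preFlow e') :
    O.clt (Sum.inr e) (Sum.inr e') :=
  (Relation.TransGen.single (show O.arc (Sum.inr e) (Sum.inl b) from ⟨v, h⟩)).tail
    (show O.arc (Sum.inl b) (Sum.inr e') from ⟨v', h'⟩)

theorem evLE_of_post_pre {e e' : O.Trans} {b : O.Place} {v v' : Var}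
    (h : (b, v) ∈ O.postFlow e) (h' : (b, v') ∈ O.preFlow e') : O.evLE e e' :=
  (clt_of_post_pre h h').to_reflTransGen

theorem eq_or_mem_of_evLE (hU : O.UniqueProducer) {C : Set O.Trans} (hC : O.CausallyClosed C)
    {e : O.Trans} (hpre : ∀ bv ∈ O.preFlow e, bv.1 ∈ O.cut C) {e' : O.Trans}
    (h : O.evLE e' e) : e' = e ∨ e' ∈ C := by
  refine (evLE_cases h).imp_right ?_
  rintro ⟨e'', b, v, v', h1, h2, h3⟩
  rcases (hpre _ h1).1 with hb | ⟨e₃, h₃, w, hw⟩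
  · exact absurd h2 (condPre_eq_none_iff.1 hb _ _)
  · obtain ⟨rfl, -⟩ := hU hw h2
    exact hC _ h₃ _ h3

theorem CausallyClosed.insert (hU : O.UniqueProducer) {C : Set O.Trans}
    (hC : O.CausallyClosed C) {e : O.Trans} (hpre : ∀ bv ∈ O.preFlow e, bv.1 ∈ O.cut C) :
    O.CausallyClosed (insert e C) := by
  rintro e₁ (rfl | he₁) e' h
  · exact eq_or_mem_of_evLE hU hC hpre h
  · exact Or.inr (hC _ he₁ _ h)

theorem ConflictFree.insert (hU : O.UniqueProducer) {C : Set O.Trans}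
    (hC : O.CausallyClosed C) (hF : O.ConflictFree C) {e : O.Trans}
    (hpre : ∀ bv ∈ O.preFlow e, bv.1 ∈ O.cut C) : O.ConflictFree (insert e C) := by
  rintro x hx y hy ⟨b, t₁, t₂, hne, ⟨v₁, h₁⟩, ⟨v₂, h₂⟩, hx', hy'⟩
  have hC' := hC.insert hU hpre
  rcases hC' _ hx _ hx' with rfl | ht₁ <;> rcases hC' _ hy _ hy' with rfl | ht₂
  · exact hne rfl
  · exact (hpre _ h₁).2 ⟨_, ht₂, _, h₂⟩
  · exact (hpre _ h₂).2 ⟨_, ht₁, _, h₁⟩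
  · exact hF _ ht₁ _ ht₂ ⟨b, t₁, t₂, hne, ⟨v₁, h₁⟩, ⟨v₂, h₂⟩,
      Relation.ReflTransGen.refl, Relation.ReflTransGen.refl⟩

theorem not_mem_postFlow_of_mem_cut (hU : O.UniqueProducer) {C : Set O.Trans} {e : O.Trans}
    (he : e ∉ C) {b : O.Place} (hb : b ∈ O.cut C) (v : Var) : (b, v) ∉ O.postFlow e := by
  intro h
  rcases hb.1 with hb | ⟨e₃, h₃, w, hw⟩
  · exact condPre_eq_none_iff.1 hb _ _ h
  · obtain ⟨rfl, -⟩ := hU hw h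
    exact he h₃

/-- Let the variables of the event `e` take the values given by `σ`. -/
def setMode (ι : O.Assign) (e : O.Trans) (σ : Var → Color) : O.Assign
  | Sum.inl (e', v) => if e' = e then σ v else ι (Sum.inl (e', v))
  | Sum.inr b => ι (Sum.inr b)

theorem setMode_self (ι : O.Assign) (e : O.Trans) (σ : Var → Color) (v : Var) :
    setMode ι e σ (Sum.inl (e, v)) = σ v := by
  simp [setMode]

theorem setMode_of_ne (ι : O.Assign) {e e' : O.Trans} (h : e' ≠ e) (σ : Var → Color)
    (v : Var) : setMode ι e σ (Sum.inl (e', v)) = ι (Sum.inl (e', v)) := by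
  simp [setMode, h]

theorem valOf_setMode {ι : O.Assign} {e : O.Trans} {σ : Var → Color} {b : O.Place}
    (hb : ∀ v, (b, v) ∉ O.postFlow e) : O.valOf (setMode ι e σ) b = O.valOf ι b := by
  rcases hc : O.condPre b with - | ⟨e', v⟩
  · simp [valOf_of_none hc, setMode]
  · rw [valOf_of_some hc, valOf_of_some hc, setMode_of_ne]
    rintro rfl
    exact hb _ (mem_postFlow_of_condPre hc)

theorem mem_cutMark {C : Set O.Trans} {hfin : (O.cut C).Finite} {ι : O.Assign}
    {b : O.Place} {c : Color} :
    (b, c) ∈ O.cutMark hfin ι ↔ b ∈ O.cut C ∧ O.valOf ι b = c := by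
  simp [cutMark]

theorem mem_cut_of_fires {C : Set O.Trans} {hfin : (O.cut C).Finite} {ι : O.Assign}
    {e : O.Trans} {σ : Var → Color} (h : O.fires (O.cutMark hfin ι) e σ) :
    ∀ bv ∈ O.preFlow e, bv.1 ∈ O.cut C ∧ O.valOf ι bv.1 = σ bv.2 := fun _ hbv =>
  mem_cutMark.1 (Multiset.mem_of_le h.2
    (Multiset.mem_map_of_mem (fun x : O.Place × Var => (x.1, σ x.2)) hbv))

theorem isInst_insert (hU : O.UniqueProducer) {C : Set O.Trans} (hC : O.CausallyClosed C)
    {ι : O.Assign} (hι : O.IsInst C ι) {e : O.Trans} (he : e ∉ C) {σ : Var → Color}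
    (hg : O.guard e σ)
    (hpre : ∀ bv ∈ O.preFlow e, bv.1 ∈ O.cut C ∧ O.valOf ι bv.1 = σ bv.2) :
    O.IsInst (insert e C) (setMode ι e σ) := by
  have hbot : O.predBot (setMode ι e σ) := hι.1
  have hloc : ∀ e' ∈ insert e C, O.locPred e' (setMode ι e σ) := by
    rintro e' (rfl | he')
    · refine ⟨by simpa only [setMode_self] using hg, fun bv hbv => ?_⟩
      rw [setMode_self, valOf_setMode (not_mem_postFlow_of_mem_cut hU he (hpre bv hbv).1),
        (hpre bv hbv).2]
    · have hne : e' ≠ e := fun h => he (h ▸ he')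
      have hl := (hι.2 e' he').2 e' Relation.ReflTransGen.refl
      refine ⟨by simpa only [setMode_of_ne ι hne] using hl.1, fun bv hbv => ?_⟩
      rw [setMode_of_ne ι hne, valOf_setMode]
      · exact hl.2 bv hbv
      · exact fun v hv => he (hC _ he' _ (evLE_of_post_pre hv hbv))
  have hC' := hC.insert hU (fun bv hbv => (hpre bv hbv).1)
  exact ⟨hbot, fun e₁ h₁ => ⟨hbot, fun e' h' => hloc _ (hC' _ h₁ _ h')⟩⟩

theorem preMark_mapT (h : Hom O N) {e : O.Trans} {ι : O.Assign} (hl : O.locPred e ι) :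
    N.preMark (h.mapT e) (fun v => ι (Sum.inl (e, v))) =
      ((O.preFlow e).map Prod.fst).map fun b => (h.mapP b, O.valOf ι b) := by
  rw [preMark, h.pre_eq, Multiset.map_map, Multiset.map_map]
  refine Multiset.map_congr rfl fun bv hbv => ?_
  simp [hl.2 bv hbv]

theorem postMark_mapT (hU : O.UniqueProducer) (h : Hom O N) (e : O.Trans) (ι : O.Assign) :
    N.postMark (h.mapT e) (fun v => ι (Sum.inl (e, v))) =
      ((O.postFlow e).map Prod.fst).map fun b => (h.mapP b, O.valOf ι b) := by
  rw [postMark, h.post_eq, Multiset.map_map, Multiset.map_map]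
  refine Multiset.map_congr rfl fun bv hbv => ?_
  simp [valOf_of_some (hU.condPre_eq_some hbv)]

theorem cut_insert (hO : O.IsOccNet) {C : Set O.Trans} (hC : O.CausallyClosed C)
    {e : O.Trans} (he : e ∉ C) :
    O.cut (insert e C) =
      (O.cut C \ {b | b ∈ (O.preFlow e).map Prod.fst}) ∪ {b | b ∈ (O.postFlow e).map Prod.fst} := by
  ext b
  simp only [cut, preConds, postConds, Set.mem_sdiff, Set.mem_union, Set.mem_ofPred_eq,
    Set.mem_insert_iff, Multiset.mem_map, Prod.exists, exists_and_right, exists_eq_right,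
    exists_eq_or_imp, not_or]
  constructor
  · rintro ⟨hb | hb | hb, h1, h2⟩
    · exact Or.inl ⟨⟨Or.inl hb, h2⟩, h1⟩
    · exact Or.inr hb
    · exact Or.inl ⟨⟨Or.inr hb, h2⟩, h1⟩
  · rintro (⟨⟨hb | hb, h2⟩, h1⟩ | ⟨v, hv⟩)
    · exact ⟨Or.inl hb, h1, h2⟩
    · exact ⟨Or.inr (Or.inr hb), h1, h2⟩
    · refine ⟨Or.inr (Or.inl ⟨v, hv⟩), ?_, ?_⟩
      · rintro ⟨v', hv'⟩
        exact hO.2.2.2.1 _ (clt_of_post_pre hv hv')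
      · rintro ⟨e', he', v', hv'⟩
        exact he (hC _ he' _ (evLE_of_post_pre hv hv'))

theorem finite_cut_insert (hO : O.IsOccNet) {C : Set O.Trans} (hC : O.CausallyClosed C)
    {e : O.Trans} (he : e ∉ C) (hfin : (O.cut C).Finite) : (O.cut (insert e C)).Finite := by
  rw [cut_insert hO hC he]
  exact (hfin.subset Set.sdiff_subset).union (Multiset.finite_toSet _)

theorem firesTo_mark_insert (hO : O.IsOccNet) (h : Hom O N) {C : Set O.Trans}
    (hC : O.CausallyClosed C) {e : O.Trans} (he : e ∉ C)
    (hpre : ∀ bv ∈ O.preFlow e, bv.1 ∈ O.cut C) {ι : O.Assign} (hl : O.locPred e ι)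
    (hfin : (O.cut C).Finite) (hfin' : (O.cut (insert e C)).Finite) :
    N.firesTo (mark h hfin ι) (h.mapT e) (fun v => ι (Sum.inl (e, v))) (mark h hfin' ι) := by
  have hU := hO.uniqueProducer
  set P : Finset O.Place := ⟨_, hO.nodup_pre e⟩ with hP
  set Q : Finset O.Place := ⟨_, hO.nodup_post e⟩ with hQ
  have hPsub : P ⊆ hfin.toFinset := by
    intro b hb
    obtain ⟨bv, hbv, rfl⟩ := Multiset.mem_map.1 hb
    simpa using hpre bv hbv
  have hdisj : Disjoint (hfin.toFinset \ P) Q := by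
    rw [Finset.disjoint_left]
    intro b hb hb'
    obtain ⟨bv, hbv, rfl⟩ := Multiset.mem_map.1 hb'
    have := (Finset.mem_sdiff.1 hb).1
    exact not_mem_postFlow_of_mem_cut hU he (hfin.mem_toFinset.1 this) bv.2 hbv
  have hcut : hfin'.toFinset = (hfin.toFinset \ P).disjUnion Q hdisj := by
    ext b
    rw [Set.Finite.mem_toFinset, cut_insert hO hC he, Finset.mem_disjUnion, Finset.mem_sdiff,
      Set.Finite.mem_toFinset]
    rfl
  have hsplit : hfin.toFinset.val = (hfin.toFinset \ P).val + P.val := by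
    rw [Finset.sdiff_val, tsub_add_cancel_of_le (Finset.val_le_iff.2 hPsub)]
  have hpm := preMark_mapT h hl
  have hqm := postMark_mapT hU h e ι
  refine ⟨⟨(h.guard_iff _ _).1 hl.1, ?_⟩, ?_⟩
  · rw [hpm, mark]
    exact Multiset.map_le_map (Finset.val_le_iff.2 hPsub)
  · rw [hpm, hqm, mark, mark, hcut, hsplit, Multiset.map_add, add_tsub_cancel_right]
    exact Multiset.map_add _ _ _

theorem mark_setMode (hU : O.UniqueProducer) (h : Hom O N) {C : Set O.Trans} {e : O.Trans}
    (he : e ∉ C) (hfin : (O.cut C).Finite) (ι : O.Assign) (σ : Var → Color) :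
    mark h hfin (setMode ι e σ) = mark h hfin ι := by
  refine Multiset.map_congr rfl fun b hb => ?_
  rw [valOf_setMode (not_mem_postFlow_of_mem_cut hU he (hfin.mem_toFinset.1 hb))]

theorem cut_empty : O.cut ∅ = O.B0 := by
  simp [cut, postConds, preConds]

theorem mark_empty_mem_init (hO : O.IsOccNet) {h : Hom O N} (hh : h.Initial)
    {ι : O.Assign} (hι : O.predBot ι) (hfin : (O.cut ∅).Finite) : mark h hfin ι ∈ N.init := by
  obtain ⟨K, hK, hKι⟩ := hι
  have hfst : K.map Prod.fst = hfin.toFinset.val := by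
    ext b
    rw [hO.mem_init_count hK, Multiset.count_eq_of_nodup hfin.toFinset.nodup]
    simp [cut_empty]
  rw [← hh]
  refine ⟨K, hK, ?_⟩
  rw [mark, ← hfst, Hom.mapMarking, Multiset.map_map]
  refine Multiset.map_congr rfl fun bc hbc => ?_
  have hb : bc.1 ∈ hfin.toFinset.val := hfst ▸ Multiset.mem_map_of_mem _ hbc
  have hb : O.condPre bc.1 = none := by
    have := hfin.mem_toFinset.1 hb
    rwa [cut_empty] at this
  simp [valOf_of_none hb, hKι bc.1 bc.2 hbc]

theorem exists_maximal_event (hO : O.IsOccNet) [Finite O.Trans] {C : Set O.Trans}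
    (hne : C.Nonempty) : ∃ e ∈ C, ∀ e' ∈ C, O.evLE e e' → e' = e := by
  let r : O.Trans → O.Trans → Prop := fun x y => O.evLT y x
  have : IsTrans O.Trans r := ⟨fun _ _ _ h1 h2 => Relation.TransGen.trans h2 h1⟩
  have : Std.Irrefl r := ⟨fun x => hO.2.2.2.1 _⟩
  obtain ⟨e, he, hmin⟩ := (Finite.wellFounded_of_trans_of_irrefl r).has_min C hne
  refine ⟨e, he, fun e' he' hle => ?_⟩
  rcases Relation.reflTransGen_iff_eq_or_transGen.1 hle with h | h
  · exact Sum.inr_injective h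
  · exact absurd h (hmin e' he')

theorem reachSteps_mark [Finite O.Place] [Finite O.Trans] (hO : O.IsOccNet) {h : Hom O N}
    (hh : h.Initial) {ι : O.Assign} (n : ℕ) :
    ∀ C : Set O.Trans, C.ncard = n → O.CausallyClosed C → O.ConflictFree C → O.IsInst C ι →
      ∀ hfin : (O.cut C).Finite, N.ReachSteps n (mark h hfin ι) := by
  induction n with
  | zero =>
    intro C hn _ _ hι hfin
    obtain rfl := (Set.ncard_eq_zero C.toFinite).1 hn
    exact mark_empty_mem_init hO hh hι.1 hfin
  | succ n ih =>
    intro C hn hC hF hι hfin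
    have hne : C.Nonempty := by
      rw [← Set.ncard_pos C.toFinite]
      omega
    obtain ⟨e, he, hmax⟩ := exists_maximal_event hO hne
    have hins : insert e (C \ {e}) = C := Set.insert_sdiff_self_of_mem he
    have he' : e ∉ C \ {e} := fun h => h.2 rfl
    have hC' : O.CausallyClosed (C \ {e}) := by
      rintro e₁ ⟨h₁, hne₁⟩ e₂ h₂
      refine ⟨hC _ h₁ _ h₂, ?_⟩
      rintro rfl
      exact hne₁ (hmax _ h₁ h₂)
    have hpre : ∀ bv ∈ O.preFlow e, bv.1 ∈ O.cut (C \ {e}) := by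
      intro bv hbv
      refine ⟨?_, ?_⟩
      · rcases hc : O.condPre bv.1 with - | ev
        · exact Or.inl hc
        · have hev := mem_postFlow_of_condPre hc
          refine Or.inr ⟨ev.1, ⟨hC _ he _ (evLE_of_post_pre hev hbv), ?_⟩, ev.2, hev⟩
          intro heq
          have := clt_of_post_pre hev hbv
          rw [Set.mem_singleton_iff.1 heq] at this
          exact hO.2.2.2.1 _ this
      · rintro ⟨e₁, ⟨h₁, hne₁⟩, v, hv⟩
        exact hF _ h₁ _ he ⟨bv.1, e₁, e, hne₁, ⟨v, hv⟩, ⟨bv.2, hbv⟩,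
          Relation.ReflTransGen.refl, Relation.ReflTransGen.refl⟩
    have hfin₁ : (O.cut (C \ {e})).Finite := Set.toFinite _
    have hfin₂ : (O.cut (insert e (C \ {e}))).Finite := Set.toFinite _
    have hstep := firesTo_mark_insert hO h hC' he' hpre
      ((hι.2 e he).2 e Relation.ReflTransGen.refl) hfin₁ hfin₂
    have hmark : mark h hfin₂ ι = mark h hfin ι := by
      simp only [mark, hins]
    rw [hmark] at hstep
    refine ⟨_, _, _, ih (C \ {e}) ?_ hC' (fun x hx y hy => hF x hx.1 y hy.1)
      ⟨hι.1, fun x hx => hι.2 x hx.1⟩ hfin₁, hstep⟩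
    have := Set.ncard_sdiff_singleton_add_one he C.toFinite
    omega

theorem boundedReach_of_complete {h : Hom O N} (hh : IsSBP h) (hfin : O.NetFinite)
    (hc : Complete h) : N.BoundedReach (Nat.card O.Trans) := by
  intro M hM
  have := hfin.1
  have := hfin.2
  obtain ⟨C, hC, -, ι, hι, hcut, rfl, -⟩ := hc M hM
  exact ⟨C.ncard, Set.ncard_le_card C, reachSteps_mark hh.1 hh.2.1 _ C rfl hC.1 hC.2.1 hι hcut⟩

end Basic

section Extend

variable {Color Var : Type} {O N : HLNet Color Var}

/-- An enumeration with multiplicities of the elements of a multiset. -/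
def enum {α : Type} (s : Multiset α) (i : Fin s.card) : α :=
  s.toList.get (i.cast s.length_toList.symm)

theorem map_enum {α : Type} (s : Multiset α) : Finset.univ.val.map (enum s) = s := by
  rw [Fin.univ_val_map]
  conv_rhs => rw [← s.coe_toList, ← List.ofFn_get s.toList]
  rw [Multiset.coe_eq_coe]
  refine List.Perm.of_eq ?_
  rw [List.ofFn_congr s.length_toList.symm]
  rfl

/-- The possible extensions of a branching process `(O, h)`: pairs of a transition `t` and a
preset of conditions labelled like the preset of `t`, such that `t` is enabled on this preset
in some cut of `O`, but is not yet represented by an event with this preset. -/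
abbrev NewEvent (h : Hom O N) : Type :=
  {x : N.Trans × Multiset (O.Place × Var) //
    (x.2.map fun bv => (h.mapP bv.1, bv.2)) = N.preFlow x.1 ∧
    (∃ C ι, O.IsConfig C ∧ O.IsInst C ι ∧ ∃ (hfin : (O.cut C).Finite) (σ : Var → Color),
      N.guard x.1 σ ∧ (x.2.map fun bv => (bv.1, σ bv.2)) ≤ O.cutMark hfin ι) ∧
    ∀ e, O.preFlow e = x.2 → h.mapT e ≠ x.1}

/-- The extension of a branching process by all its possible extensions. -/
abbrev extend (h : Hom O N) : HLNet Color Var where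
  Place := O.Place ⊕ (Σ x : NewEvent h, Fin (N.postFlow x.1.1).card)
  Trans := O.Trans ⊕ NewEvent h
  preFlow := Sum.elim (fun e => (O.preFlow e).map fun bv => (Sum.inl bv.1, bv.2))
    fun x => x.1.2.map fun bv => (Sum.inl bv.1, bv.2)
  postFlow := Sum.elim (fun e => (O.postFlow e).map fun bv => (Sum.inl bv.1, bv.2))
    fun x => Finset.univ.val.map fun i => (Sum.inr ⟨x, i⟩, (enum (N.postFlow x.1.1) i).2)
  guard := Sum.elim O.guard fun x => N.guard x.1.1
  init := (fun M : O.Marking => M.map fun bc => (Sum.inl bc.1, bc.2)) '' O.init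

/-- The labelling of the extension of a branching process. -/
abbrev extendHom (h : Hom O N) : Hom (extend h) N where
  mapP := Sum.elim h.mapP fun y => (enum (N.postFlow y.1.1.1) y.2).1
  mapT := Sum.elim h.mapT fun x => x.1.1
  guard_iff := by
    rintro (e | x) σ
    · exact h.guard_iff e σ
    · exact Iff.rfl
  pre_eq := by
    rintro (e | x)
    · simp [extend, h.pre_eq, Function.comp_def]
    · simp [extend, ← x.2.1, Function.comp_def]
  post_eq := by
    rintro (e | x)
    · simp [extend, h.post_eq, Function.comp_def]
    · simp only [extend, Sum.elim_inr, Multiset.map_map]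
      exact (map_enum _).symm

variable {h : Hom O N}

theorem mem_extend_pre_inl {b : (extend h).Place} {v : Var} {e : O.Trans} :
    (b, v) ∈ (extend h).preFlow (Sum.inl e) ↔
      ∃ b', b = Sum.inl b' ∧ (b', v) ∈ O.preFlow e := by
  simp only [extend, Sum.elim_inl, Multiset.mem_map, Prod.mk.injEq, Prod.exists]
  constructor
  · rintro ⟨b', v', h1, rfl, rfl⟩
    exact ⟨b', rfl, h1⟩
  · rintro ⟨b', rfl, h1⟩
    exact ⟨b', v, h1, rfl, rfl⟩

theorem mem_extend_pre_inr {b : (extend h).Place} {v : Var} {x : NewEvent h} :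
    (b, v) ∈ (extend h).preFlow (Sum.inr x) ↔ ∃ b', b = Sum.inl b' ∧ (b', v) ∈ x.1.2 := by
  simp only [extend, Sum.elim_inr, Multiset.mem_map, Prod.mk.injEq, Prod.exists]
  constructor
  · rintro ⟨b', v', h1, rfl, rfl⟩
    exact ⟨b', rfl, h1⟩
  · rintro ⟨b', rfl, h1⟩
    exact ⟨b', v, h1, rfl, rfl⟩

theorem mem_extend_post_inl {b : (extend h).Place} {v : Var} {e : O.Trans} :
    (b, v) ∈ (extend h).postFlow (Sum.inl e) ↔
      ∃ b', b = Sum.inl b' ∧ (b', v) ∈ O.postFlow e := by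
  simp only [extend, Sum.elim_inl, Multiset.mem_map, Prod.mk.injEq, Prod.exists]
  constructor
  · rintro ⟨b', v', h1, rfl, rfl⟩
    exact ⟨b', rfl, h1⟩
  · rintro ⟨b', rfl, h1⟩
    exact ⟨b', v, h1, rfl, rfl⟩

theorem mem_extend_post_inr {b : (extend h).Place} {v : Var} {x : NewEvent h} :
    (b, v) ∈ (extend h).postFlow (Sum.inr x) ↔
      ∃ i, b = Sum.inr ⟨x, i⟩ ∧ v = (enum (N.postFlow x.1.1) i).2 := by
  simp only [extend, Sum.elim_inr, Multiset.mem_map, Prod.mk.injEq, Finset.mem_val,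
    Finset.mem_univ, true_and]
  exact exists_congr fun i => and_congr eq_comm eq_comm

theorem mem_extend_post_of_inl {b : O.Place} {v : Var} {e : (extend h).Trans} :
    (Sum.inl b, v) ∈ (extend h).postFlow e ↔
      ∃ e', e = Sum.inl e' ∧ (b, v) ∈ O.postFlow e' := by
  rcases e with e | x
  · rw [mem_extend_post_inl]
    constructor
    · rintro ⟨b', h1, h2⟩
      cases h1
      exact ⟨e, rfl, h2⟩
    · rintro ⟨e', h1, h2⟩
      cases h1
      exact ⟨b, rfl, h2⟩
  · rw [mem_extend_post_inr]
    constructor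
    · rintro ⟨i, h1, -⟩
      cases h1
    · rintro ⟨e', h1, -⟩
      cases h1

theorem mem_extend_post_of_inr {y : Σ x : NewEvent h, Fin (N.postFlow x.1.1).card} {v : Var}
    {e : (extend h).Trans} :
    (Sum.inr y, v) ∈ (extend h).postFlow e ↔
      e = Sum.inr y.1 ∧ v = (enum (N.postFlow y.1.1.1) y.2).2 := by
  rcases e with e | x
  · rw [mem_extend_post_inl]
    constructor
    · rintro ⟨b', h1, -⟩
      cases h1
    · rintro ⟨h1, -⟩
      cases h1
  · rw [mem_extend_post_inr]
    constructor
    · rintro ⟨i, h1, h2⟩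
      cases h1
      exact ⟨rfl, h2⟩
    · rintro ⟨h1, h2⟩
      cases h1
      exact ⟨y.2, rfl, h2⟩

theorem uniqueProducer_extend (hU : O.UniqueProducer) : (extend h).UniqueProducer := by
  rintro (b | y) e v e' v' h1 h2
  · obtain ⟨e, rfl, h1'⟩ := mem_extend_post_of_inl.1 h1
    obtain ⟨e', rfl, h2'⟩ := mem_extend_post_of_inl.1 h2
    obtain ⟨rfl, rfl⟩ := hU h1' h2'
    exact ⟨rfl, rfl⟩
  · obtain ⟨rfl, rfl⟩ := mem_extend_post_of_inr.1 h1
    obtain ⟨rfl, rfl⟩ := mem_extend_post_of_inr.1 h2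
    exact ⟨rfl, rfl⟩

theorem condPre_extend_inl_eq_none_iff {b : O.Place} :
    (extend h).condPre (Sum.inl b) = none ↔ O.condPre b = none := by
  rw [condPre_eq_none_iff, condPre_eq_none_iff]
  constructor
  · exact fun H e v hv => H (Sum.inl e) v (mem_extend_post_of_inl.2 ⟨e, rfl, hv⟩)
  · intro H e v hv
    obtain ⟨e', rfl, hv'⟩ := mem_extend_post_of_inl.1 hv
    exact H _ _ hv'

/-- The embedding of the nodes of a branching process into those of its extension. -/
def extendNode (h : Hom O N) : O.Node → (extend h).Node :=
  Sum.map Sum.inl Sum.inl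

theorem arc_extendNode_iff {x : (extend h).Node} {y : O.Node} :
    (extend h).arc x (extendNode h y) ↔ ∃ x', x = extendNode h x' ∧ O.arc x' y := by
  rcases y with b | e
  · constructor
    · rcases x with b' | e'
      · exact False.elim
      · rintro ⟨v, hv⟩
        obtain ⟨e, rfl, hv'⟩ := mem_extend_post_of_inl.1 hv
        exact ⟨Sum.inr e, rfl, v, hv'⟩
    · rintro ⟨b' | e', rfl, hx⟩
      · exact hx
      · obtain ⟨v, hv⟩ := hx
        exact ⟨v, mem_extend_post_of_inl.2 ⟨e', rfl, hv⟩⟩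
  · constructor
    · rcases x with b' | e'
      · rintro ⟨v, hv⟩
        obtain ⟨b, rfl, hv'⟩ := mem_extend_pre_inl.1 hv
        exact ⟨Sum.inl b, rfl, v, hv'⟩
      · exact False.elim
    · rintro ⟨b' | e', rfl, hx⟩
      · obtain ⟨v, hv⟩ := hx
        exact ⟨v, mem_extend_pre_inl.2 ⟨b', rfl, hv⟩⟩
      · exact hx

theorem cle_extendNode {x : (extend h).Node} {y : O.Node}
    (hxy : (extend h).cle x (extendNode h y)) : ∃ x', x = extendNode h x' ∧ O.cle x' y := by
  generalize hz : extendNode h y = z at hxy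
  induction hxy generalizing y with
  | refl => exact ⟨y, hz.symm, Relation.ReflTransGen.refl⟩
  | tail _ hb ih =>
    subst hz
    obtain ⟨b', rfl, hb'⟩ := arc_extendNode_iff.1 hb
    obtain ⟨x', rfl, hx'⟩ := ih rfl
    exact ⟨x', rfl, hx'.tail hb'⟩

theorem evLE_extend_inl {x : (extend h).Trans} {e : O.Trans}
    (hx : (extend h).evLE x (Sum.inl e)) : ∃ x', x = Sum.inl x' ∧ O.evLE x' e := by
  obtain ⟨b | x', hx', hle⟩ := cle_extendNode (y := Sum.inr e) hx
  · cases hx'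
  · cases hx'
    exact ⟨x', rfl, hle⟩

theorem sConflict_of_extend {e e' : O.Trans}
    (H : (extend h).SConflict (Sum.inr (Sum.inl e)) (Sum.inr (Sum.inl e'))) :
    O.SConflict (Sum.inr e) (Sum.inr e') := by
  obtain ⟨b, t₁, t₂, hne, ⟨v₁, h₁⟩, ⟨v₂, h₂⟩, hx, hy⟩ := H
  obtain ⟨t₁, rfl, hx'⟩ := evLE_extend_inl hx
  obtain ⟨t₂, rfl, hy'⟩ := evLE_extend_inl hy
  obtain ⟨b, rfl, h₁'⟩ := mem_extend_pre_inl.1 h₁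
  obtain ⟨b', hb, h₂'⟩ := mem_extend_pre_inl.1 h₂
  cases hb
  exact ⟨b, t₁, t₂, fun h => hne (h ▸ rfl), ⟨v₁, h₁'⟩, ⟨v₂, h₂'⟩, hx', hy'⟩

theorem causallyClosed_image_inl {C : Set O.Trans} (hC : O.CausallyClosed C) :
    (extend h).CausallyClosed (Sum.inl '' C) := by
  rintro _ ⟨e, he, rfl⟩ e' hle
  obtain ⟨e', rfl, hle'⟩ := evLE_extend_inl hle
  exact ⟨e', hC _ he _ hle', rfl⟩

theorem conflictFree_image_inl {C : Set O.Trans} (hF : O.ConflictFree C) :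
    (extend h).ConflictFree (Sum.inl '' C) := by
  rintro _ ⟨e, he, rfl⟩ _ ⟨e', he', rfl⟩ H
  exact hF _ he _ he' (sConflict_of_extend H)

theorem cut_image_inl (C : Set O.Trans) :
    (extend h).cut (Sum.inl '' C) = Sum.inl '' O.cut C := by
  ext b
  constructor
  · rintro ⟨hb, hpre⟩
    rcases b with b | y
    · refine ⟨b, ⟨hb.imp condPre_extend_inl_eq_none_iff.1 ?_, ?_⟩, rfl⟩
      · rintro ⟨_, ⟨e, he, rfl⟩, v, hv⟩
        obtain ⟨e', h1, h2⟩ := mem_extend_post_of_inl.1 hv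
        cases h1
        exact ⟨e, he, v, h2⟩
      · rintro ⟨e, he, v, hv⟩
        exact hpre ⟨_, ⟨e, he, rfl⟩, v, mem_extend_pre_inl.2 ⟨b, rfl, hv⟩⟩
    · rcases hb with hb | ⟨_, ⟨e, he, rfl⟩, v, hv⟩
      · exact absurd (mem_extend_post_of_inr.2 ⟨rfl, rfl⟩) (condPre_eq_none_iff.1 hb _ _)
      · cases (mem_extend_post_of_inr.1 hv).1
  · rintro ⟨b, ⟨hb, hpre⟩, rfl⟩
    refine ⟨hb.imp condPre_extend_inl_eq_none_iff.2 ?_, ?_⟩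
    · rintro ⟨e, he, v, hv⟩
      exact ⟨_, ⟨e, he, rfl⟩, v, mem_extend_post_of_inl.2 ⟨e, rfl, hv⟩⟩
    · rintro ⟨_, ⟨e, he, rfl⟩, v, hv⟩
      obtain ⟨b', h1, h2⟩ := mem_extend_pre_inl.1 hv
      cases h1
      exact hpre ⟨e, he, v, h2⟩

/-- Extend an assignment to the variables of the extension, where `τ` assigns values to the
variables of the new events. -/
def extendAssign (ι : O.Assign) (τ : NewEvent h → Var → Color) : (extend h).Assign :=
  Sum.elim
    (fun ev => Sum.elim (fun e => ι (Sum.inl (e, ev.2))) (fun x => τ x ev.2) ev.1)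
    (Sum.elim (fun b => ι (Sum.inr b)) fun y => τ y.1 (enum (N.postFlow y.1.1.1) y.2).2)

theorem valOf_extendAssign (hU : O.UniqueProducer) (ι : O.Assign)
    (τ : NewEvent h → Var → Color) (b : O.Place) :
    (extend h).valOf (extendAssign ι τ) (Sum.inl b) = O.valOf ι b := by
  rcases hc : O.condPre b with - | ev
  · rw [valOf_of_none hc, valOf_of_none (condPre_extend_inl_eq_none_iff.2 hc)]
    rfl
  · have hp := (mem_extend_post_of_inl (h := h)).2 ⟨ev.1, rfl, mem_postFlow_of_condPre hc⟩
    rw [valOf_of_some hc, valOf_of_some ((uniqueProducer_extend hU).condPre_eq_some hp)]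
    rfl

theorem predBot_extendAssign {ι : O.Assign} (hι : O.predBot ι)
    (τ : NewEvent h → Var → Color) : (extend h).predBot (extendAssign ι τ) := by
  obtain ⟨K, hK, H⟩ := hι
  refine ⟨_, ⟨K, hK, rfl⟩, fun b c hbc => ?_⟩
  obtain ⟨bc, hbc', h1⟩ := Multiset.mem_map.1 hbc
  cases h1
  exact H _ _ hbc'

theorem locPred_extendAssign (hU : O.UniqueProducer) {ι : O.Assign} {e : O.Trans}
    (hl : O.locPred e ι) (τ : NewEvent h → Var → Color) :
    (extend h).locPred (Sum.inl e) (extendAssign ι τ) := by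
  refine ⟨hl.1, ?_⟩
  rintro ⟨b, v⟩ hbv
  obtain ⟨b, rfl, hb⟩ := mem_extend_pre_inl.1 hbv
  rw [valOf_extendAssign hU]
  exact hl.2 _ hb

theorem pred_extendAssign (hU : O.UniqueProducer) {ι : O.Assign} {e : O.Trans}
    (hp : O.pred e ι) (τ : NewEvent h → Var → Color) :
    (extend h).pred (Sum.inl e) (extendAssign ι τ) := by
  refine ⟨predBot_extendAssign hp.1 τ, fun e' hle => ?_⟩
  obtain ⟨e', rfl, hle'⟩ := evLE_extend_inl hle
  exact locPred_extendAssign hU (hp.2 _ hle') τ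

theorem isInst_extendAssign (hU : O.UniqueProducer) {C : Set O.Trans} {ι : O.Assign}
    (hι : O.IsInst C ι) (τ : NewEvent h → Var → Color) :
    (extend h).IsInst (Sum.inl '' C) (extendAssign ι τ) := by
  refine ⟨predBot_extendAssign hι.1 τ, ?_⟩
  rintro _ ⟨e, he, rfl⟩
  exact pred_extendAssign hU (hι.2 e he) τ

theorem isConfig_image_inl (hU : O.UniqueProducer) {C : Set O.Trans} (hC : O.IsConfig C)
    (τ : NewEvent h → Var → Color) : (extend h).IsConfig (Sum.inl '' C) :=
  ⟨causallyClosed_image_inl hC.1, conflictFree_image_inl hC.2.1,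
    ⟨_, isInst_extendAssign hU hC.2.2.choose_spec τ⟩⟩

theorem nonempty_newMode (h : Hom O N) : Nonempty (NewEvent h → Var → Color) :=
  ⟨fun x => x.2.2.1.choose_spec.choose_spec.2.2.choose_spec.choose⟩

theorem finite_cut_image_inl {C : Set O.Trans} (hfin : (O.cut C).Finite) :
    ((extend h).cut (Sum.inl '' C)).Finite := by
  rw [cut_image_inl]
  exact hfin.image _

theorem toFinset_cut_image_inl {C : Set O.Trans} (hfin : (O.cut C).Finite)
    (hfin' : ((extend h).cut (Sum.inl '' C)).Finite) :
    hfin'.toFinset = hfin.toFinset.map ⟨Sum.inl, Sum.inl_injective⟩ := by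
  ext b
  rw [Set.Finite.mem_toFinset, cut_image_inl]
  simp

theorem mark_image_inl (hU : O.UniqueProducer) {C : Set O.Trans} (hfin : (O.cut C).Finite)
    (hfin' : ((extend h).cut (Sum.inl '' C)).Finite) (ι : O.Assign)
    (τ : NewEvent h → Var → Color) :
    mark (extendHom h) hfin' (extendAssign ι τ) = mark h hfin ι := by
  rw [mark, mark, toFinset_cut_image_inl hfin, Finset.map_val, Multiset.map_map]
  refine Multiset.map_congr rfl fun b _ => ?_
  exact Prod.ext rfl (valOf_extendAssign hU ι τ b)

theorem cutMark_image_inl (hU : O.UniqueProducer) {C : Set O.Trans} (hfin : (O.cut C).Finite)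
    (hfin' : ((extend h).cut (Sum.inl '' C)).Finite) (ι : O.Assign)
    (τ : NewEvent h → Var → Color) :
    (extend h).cutMark hfin' (extendAssign ι τ) =
      (O.cutMark hfin ι).map fun bc => (Sum.inl bc.1, bc.2) := by
  rw [cutMark, cutMark, toFinset_cut_image_inl hfin, Finset.map_val, Multiset.map_map,
    Multiset.map_map]
  refine Multiset.map_congr rfl fun b _ => ?_
  exact Prod.ext rfl (valOf_extendAssign hU ι τ b)

theorem NewEvent.exists_fires (hU : O.UniqueProducer) (x : NewEvent h) :
    ∃ C ι, (extend h).IsConfig C ∧ (extend h).IsInst C ι ∧ Sum.inr x ∉ C ∧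
      ∃ (hfin : ((extend h).cut C).Finite) (σ : Var → Color),
        (extend h).fires ((extend h).cutMark hfin ι) (Sum.inr x) σ := by
  obtain ⟨τ⟩ := nonempty_newMode h
  obtain ⟨C, ι, hC, hι, hfin, σ, hg, hle⟩ := x.2.2.1
  refine ⟨_, _, isConfig_image_inl hU hC τ, isInst_extendAssign hU hι τ, ?_,
    finite_cut_image_inl hfin, σ, hg, ?_⟩
  · rintro ⟨e, -, h1⟩
    cases h1
  · rw [cutMark_image_inl hU hfin]
    refine le_trans (le_of_eq ?_) (Multiset.map_le_map hle)
    simp [preMark, extend]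

theorem wellFounded_clt_extend (hO : WellFounded O.clt) : WellFounded (extend h).clt := by
  have hwf : WellFounded O.arc :=
    Subrelation.wf (r := O.clt) (fun h => Relation.TransGen.single h) hO
  refine WellFounded.transGen ?_
  have hold : ∀ y, Acc (extend h).arc (extendNode h y) := by
    intro y
    induction y using hwf.induction with
    | _ y ih =>
      refine ⟨_, fun x hx => ?_⟩
      obtain ⟨x', rfl, hx'⟩ := arc_extendNode_iff.1 hx
      exact ih _ hx'
  have hev : ∀ e : (extend h).Trans, Acc (extend h).arc (Sum.inr e) := by
    rintro (e | x)
    · exact hold (Sum.inr e)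
    · refine ⟨_, ?_⟩
      rintro (b | e) hb
      · obtain ⟨v, hv⟩ := hb
        obtain ⟨b, rfl, -⟩ := mem_extend_pre_inr.1 hv
        exact hold (Sum.inl b)
      · exact hb.elim
  refine ⟨?_⟩
  rintro (b | e)
  · refine ⟨_, ?_⟩
    rintro (b' | e) hb
    · exact hb.elim
    · exact hev e
  · exact hev e

theorem ordinary_extend (hO : O.IsOccNet) : (extend h).Ordinary := by
  simp only [Ordinary, ← nodup_map_fst_iff]
  constructor
  · rintro (e | x)
    · have := (hO.nodup_pre e).map (Sum.inl_injective (β := Σ x : NewEvent h,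
        Fin (N.postFlow x.1.1).card))
      simpa [extend, Multiset.map_map, Function.comp_def] using this
    · obtain ⟨C, ι, hC, hι, hfin, σ, hg, hle⟩ := x.2.2.1
      have h1 : (x.1.2.map Prod.fst).Nodup := by
        have h2 : x.1.2.map Prod.fst ≤ hfin.toFinset.val := by
          have h3 := Multiset.map_le_map (f := Prod.fst) hle
          simpa [cutMark, Multiset.map_map, Function.comp_def] using h3
        exact Multiset.nodup_of_le h2 hfin.toFinset.nodup
      have := h1.map (Sum.inl_injective (β := Σ x : NewEvent h,
        Fin (N.postFlow x.1.1).card))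
      simpa [extend, Multiset.map_map, Function.comp_def] using this
  · rintro (e | x)
    · have := (hO.nodup_post e).map (Sum.inl_injective (β := Σ x : NewEvent h,
        Fin (N.postFlow x.1.1).card))
      simpa [extend, Multiset.map_map, Function.comp_def] using this
    · simp only [Sum.elim_inr, Multiset.map_map, Function.comp_def]
      refine Finset.univ.nodup.map fun i j hij => ?_
      simpa using hij

theorem isOccNet_extend (hO : O.IsOccNet) : (extend h).IsOccNet := by
  have hU := hO.uniqueProducer
  have hU' := uniqueProducer_extend (h := h) hU
  have hwf := wellFounded_clt_extend (h := h) hO.2.2.2.2.1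
  refine ⟨⟨hO.1.1.image _, ?_⟩, ordinary_extend hO, ?_, ?_, hwf, ?_⟩
  · rintro _ ⟨K, hK, rfl⟩ _ ⟨K', hK', rfl⟩
    have := congrArg (Multiset.map (Sum.inl : O.Place → (extend h).Place)) (hO.1.2 K hK K' hK')
    simpa only [Multiset.map_map, Function.comp_def] using this
  · rintro (e | x) H
    · exact hO.2.2.1 e (sConflict_of_extend H)
    · obtain ⟨C, ι, hC, hι, -, hfin, σ, hf⟩ := x.exists_fires hU
      exact ConflictFree.insert hU' hC.1 hC.2.1 (fun bv hbv => (mem_cut_of_fires hf bv hbv).1)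
        _ (Set.mem_insert _ _) _ (Set.mem_insert _ _) H
  · exact fun x hx => hwf.irrefl.irrefl x hx
  · rintro (b | y)
    · have hcount : ∀ K : O.Marking,
          ((K.map fun bc => (Sum.inl bc.1, bc.2)).filter
            fun bc : (extend h).Place × Color => bc.1 = Sum.inl b).card =
          (K.filter fun bc => bc.1 = b).card := by
        intro K
        rw [Multiset.filter_map, Multiset.card_map]
        congr 1
        exact Multiset.filter_congr fun bc _ => Sum.inl_injective.eq_iff
      refine (hO.2.2.2.2.2 b).imp ?_ ?_
      · rintro ⟨hb, hi⟩
        refine ⟨fun e v hv => ?_, ?_⟩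
        · obtain ⟨e', rfl, hv'⟩ := mem_extend_post_of_inl.1 hv
          exact hb _ _ hv'
        · rintro _ ⟨K, hK, rfl⟩
          exact (hcount K).trans (hi K hK)
      · rintro ⟨⟨e, v, hv, -⟩, hi⟩
        have hv' := (mem_extend_post_of_inl (h := h)).2 ⟨e, rfl, hv⟩
        refine ⟨⟨_, v, hv', fun e' v' h' => hU' hv' h'⟩, ?_⟩
        rintro _ ⟨K, hK, rfl⟩
        exact (hcount K).trans (hi K hK)
    · have hv' := (mem_extend_post_of_inr (y := y)).2 ⟨rfl, rfl⟩
      refine Or.inr ⟨⟨_, _, hv', fun e' v' h' => hU' hv' h'⟩, ?_⟩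
      rintro _ ⟨K, hK, rfl⟩
      rw [Multiset.card_eq_zero, Multiset.filter_eq_nil]
      intro bc hbc
      obtain ⟨bc', -, rfl⟩ := Multiset.mem_map.1 hbc
      exact Sum.inl_ne_inr

theorem isSBP_extend (hh : IsSBP h) : IsSBP (extendHom h) := by
  have hO := isOccNet_extend (h := h) hh.1
  have hU := hh.1.uniqueProducer
  obtain ⟨τ⟩ := nonempty_newMode h
  refine ⟨hO, ?_, ?_, ?_⟩
  · rw [Hom.Initial, ← hh.2.1]
    simp only [extend, Set.image_image]
    refine Set.image_congr fun K _ => ?_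
    simp only [Hom.mapMarking, Multiset.map_map]
    rfl
  · rintro (e | x)
    · obtain ⟨ι, hι⟩ := hh.2.2.1 e
      exact ⟨_, pred_extendAssign hU hι τ⟩
    · obtain ⟨C, ι, hC, hι, hx, hfin, σ, hf⟩ := x.exists_fires hU
      exact ⟨_, (isInst_insert hO.uniqueProducer hC.1 hι hx hf.1 (mem_cut_of_fires hf)).2 _
        (Set.mem_insert _ _)⟩
  · have hinj : Function.Injective fun bv : O.Place × Var =>
        ((Sum.inl bv.1, bv.2) : (extend h).Place × Var) := by
      rintro ⟨b, v⟩ ⟨b', v'⟩ H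
      simpa using H
    have hinj' := Multiset.map_injective hinj
    rintro (e | x) (e' | x') h1 h2
    · exact congrArg _ (hh.2.2.2 e e' (hinj' h1) h2)
    · exact absurd h2 (x'.2.2.2 e (hinj' h1))
    · exact absurd h2.symm (x.2.2.2 e' (hinj' h1).symm)
    · exact congrArg _ (Subtype.ext (Prod.ext h2 (hinj' h1)))

theorem finite_newEvent (hN : N.NetFinite) (hO : O.NetFinite) : Finite (NewEvent h) := by
  have := hN.2
  have := hO.1
  cases nonempty_fintype O.Place
  have hfin : (⋃ t : N.Trans, {t} ×ˢ
      Set.Iic ((Finset.univ : Finset O.Place) ×ˢ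
        ((N.preFlow t).map Prod.snd).toFinset).val).Finite :=
    Set.finite_iUnion fun t => (Set.finite_singleton t).prod (Set.finite_Iic _)
  refine (hfin.subset ?_).to_subtype
  rintro ⟨t, m⟩ ⟨hm, ⟨C, ι, hC, hι, hcut, σ, hg, hle⟩, -⟩
  refine Set.mem_iUnion.2 ⟨t, rfl, ?_⟩
  have h2 : m.map Prod.fst ≤ hcut.toFinset.val := by
    have h3 := Multiset.map_le_map (f := Prod.fst) hle
    simpa [cutMark, Multiset.map_map, Function.comp_def] using h3
  have hnd : m.Nodup := Multiset.Nodup.of_map _ (Multiset.nodup_of_le h2 hcut.toFinset.nodup)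
  refine (Multiset.le_iff_subset hnd).2 fun bv hbv => ?_
  have h4 : (h.mapP bv.1, bv.2) ∈ N.preFlow t :=
    hm ▸ Multiset.mem_map_of_mem (fun bv : O.Place × Var => (h.mapP bv.1, bv.2)) hbv
  simp only [Finset.mem_val, Finset.mem_product, Finset.mem_univ, true_and,
    Multiset.mem_toFinset, Multiset.mem_map]
  exact ⟨_, h4, rfl⟩

theorem netFinite_extend (hN : N.NetFinite) (hO : O.NetFinite) : (extend h).NetFinite := by
  have := finite_newEvent (h := h) hN hO
  have := hO.1
  have := hO.2
  exact ⟨inferInstanceAs (Finite (O.Place ⊕ (Σ x : NewEvent h, Fin (N.postFlow x.1.1).card))),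
    inferInstanceAs (Finite (O.Trans ⊕ NewEvent h))⟩

theorem exists_lift_of_map_le_map {α β γ : Type} (f : α → γ) (g : β → γ) (s : Multiset α) :
    ∀ u : Multiset β, s.map f ≤ u.map g →
      ∃ m : Multiset (β × α), m.map Prod.snd = s ∧ m.map Prod.fst ≤ u ∧
        ∀ x ∈ m, g x.1 = f x.2 := by
  induction s using Multiset.induction with
  | empty => exact fun u _ => ⟨0, by simp⟩
  | cons a s ih =>
    intro u hu
    rw [Multiset.map_cons] at hu
    obtain ⟨b, hb, hba⟩ :=
      Multiset.mem_map.1 (Multiset.mem_of_le hu (Multiset.mem_cons_self _ _))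
    obtain ⟨u, rfl⟩ := Multiset.exists_cons_of_mem hb
    rw [Multiset.map_cons, hba, Multiset.cons_le_cons_iff] at hu
    obtain ⟨m, h1, h2, h3⟩ := ih u hu
    refine ⟨(b, a) ::ₘ m, by simp [h1], by simpa using h2, ?_⟩
    simpa [hba] using h3

theorem exists_extend_fires (hU : O.UniqueProducer) {C : Set O.Trans} {ι : O.Assign}
    (hC : O.IsConfig C) (hι : O.IsInst C ι) (hfin : (O.cut C).Finite)
    (hfin' : ((extend h).cut (Sum.inl '' C)).Finite) (τ : NewEvent h → Var → Color)
    {t : N.Trans} {σ : Var → Color} (hf : N.fires (mark h hfin ι) t σ) :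
    ∃ e, (extendHom h).mapT e = t ∧
      (extend h).fires ((extend h).cutMark hfin' (extendAssign ι τ)) e σ := by
  obtain ⟨m, hsnd, hfst, hm⟩ := exists_lift_of_map_le_map
    (fun pv : N.Place × Var => (pv.1, σ pv.2)) (fun b => (h.mapP b, O.valOf ι b))
    (N.preFlow t) hfin.toFinset.val hf.2
  simp only [Prod.mk.injEq] at hm
  set p : Multiset (O.Place × Var) := m.map fun x => (x.1, x.2.2) with hp
  have hlabel : (p.map fun bv => (h.mapP bv.1, bv.2)) = N.preFlow t := by
    rw [hp, ← hsnd, Multiset.map_map]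
    exact Multiset.map_congr rfl fun x hx => Prod.ext (hm x hx).1 rfl
  have hle : (p.map fun bv => (bv.1, σ bv.2)) ≤ O.cutMark hfin ι := by
    refine le_trans (le_of_eq ?_)
      (Multiset.map_le_map (f := fun b => (b, O.valOf ι b)) hfst)
    rw [hp, Multiset.map_map, Multiset.map_map]
    exact Multiset.map_congr rfl fun x hx => Prod.ext rfl (hm x hx).2.symm
  have hle' : ((p.map fun bv => ((Sum.inl bv.1, bv.2) : (extend h).Place × Var)).map
      fun bv => (bv.1, σ bv.2)) ≤ (extend h).cutMark hfin' (extendAssign ι τ) := by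
    rw [cutMark_image_inl hU hfin]
    refine le_trans (le_of_eq ?_) (Multiset.map_le_map hle)
    simp [Multiset.map_map]
  by_cases hex : ∃ e, O.preFlow e = p ∧ h.mapT e = t
  · obtain ⟨e, he, rfl⟩ := hex
    refine ⟨Sum.inl e, rfl, (h.guard_iff e σ).2 hf.1, ?_⟩
    rw [← he] at hle'
    exact hle'
  · push Not at hex
    exact ⟨Sum.inr ⟨(t, p), hlabel, ⟨C, ι, hC, hι, hfin, σ, hf.1, hle⟩, hex⟩, rfl, hf.1, hle'⟩

end Extend

section Existence

variable {Color Var : Type} {O N : HLNet Color Var}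

/-- The occurrence net without events that has one condition for every element of a multiset
of places, with the initial cuts corresponding to the initial markings of `N`. -/
abbrev initNet (N : HLNet Color Var) (s : Multiset N.Place) : HLNet Color Var where
  Place := Fin s.card
  Trans := Empty
  preFlow := Empty.elim
  postFlow := Empty.elim
  guard := Empty.elim
  init := {K | ∃ c : Fin s.card → Color, K = Finset.univ.val.map (fun b => (b, c b)) ∧
    Finset.univ.val.map (fun b => (enum s b, c b)) ∈ N.init}

/-- The labelling of `initNet`. -/
abbrev initHom (N : HLNet Color Var) (s : Multiset N.Place) : Hom (initNet N s) N where
  mapP := enum s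
  mapT := Empty.elim
  guard_iff e := e.elim
  pre_eq e := e.elim
  post_eq e := e.elim

theorem exists_eq_map_of_map_fst_eq {α β γ : Type} [Nonempty γ] (f : β → α)
    (s : Multiset β) : s.Nodup → ∀ M : Multiset (α × γ), M.map Prod.fst = s.map f →
      ∃ c : β → γ, M = s.map fun b => (f b, c b) := by
  induction s using Multiset.induction with
  | empty =>
    intro _ M hM
    exact ⟨fun _ => Classical.arbitrary γ, by simpa using hM⟩
  | cons b s ih =>
    intro hs M hM
    rw [Multiset.nodup_cons] at hs
    rw [Multiset.map_cons] at hM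
    obtain ⟨⟨a, x⟩, hx, rfl⟩ :=
      Multiset.mem_map.1 (hM ▸ Multiset.mem_cons_self (f b) (s.map f))
    obtain ⟨M, rfl⟩ := Multiset.exists_cons_of_mem hx
    rw [Multiset.map_cons] at hM
    obtain ⟨c, rfl⟩ := ih hs.2 M ((Multiset.cons_inj_right _).1 hM)
    refine ⟨Function.update c b x, ?_⟩
    rw [Multiset.map_cons, Function.update_self]
    congr 1
    refine Multiset.map_congr rfl fun b' hb' => ?_
    rw [Function.update_of_ne]
    rintro rfl
    exact hs.1 hb'

theorem exists_coloring {α γ : Type} (M : Multiset (α × γ)) {s : Multiset α}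
    (hM : M.map Prod.fst = s) :
    ∃ c : Fin s.card → γ, M = Finset.univ.val.map fun b => (enum s b, c b) := by
  rcases isEmpty_or_nonempty γ with hγ | hγ
  · obtain rfl : M = 0 := Multiset.eq_zero_of_forall_notMem fun x => hγ.elim x.2
    subst hM
    exact ⟨fun i => i.elim0, rfl⟩
  · exact exists_eq_map_of_map_fst_eq _ _ Finset.univ.nodup M (by rw [map_enum, hM])

theorem initNet_arc_false {s : Multiset N.Place} (x y : (initNet N s).Node) :
    ¬ (initNet N s).arc x y := by
  rcases x with x | x <;> rcases y with y | y
  · exact id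
  · exact y.elim
  · exact x.elim
  · exact id

theorem isOccNet_initNet {M₀ : N.Marking} (hM₀ : M₀ ∈ N.init) :
    (initNet N (M₀.map Prod.fst)).IsOccNet := by
  have hfst : ∀ K ∈ (initNet N (M₀.map Prod.fst)).init,
      K.map Prod.fst = Finset.univ.val := by
    rintro _ ⟨c, rfl, -⟩
    rw [Multiset.map_map]
    exact Multiset.map_id _
  refine ⟨⟨?_, ?_⟩, ⟨fun e => e.elim, fun e => e.elim⟩, fun e => e.elim, ?_, ?_, ?_⟩
  · obtain ⟨c, hc⟩ := exists_coloring M₀ rfl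
    exact ⟨_, c, rfl, hc ▸ hM₀⟩
  · intro K hK K' hK'
    rw [hfst K hK, hfst K' hK']
  · intro x hx
    obtain ⟨y, -, h⟩ := Relation.TransGen.tail'_iff.1 hx
    exact initNet_arc_false _ _ h
  · refine WellFounded.transGen ⟨fun x => ⟨_, fun y h => ?_⟩⟩
    exact absurd h (initNet_arc_false _ _)
  · refine fun b => Or.inl ⟨fun e => e.elim, fun K hK => ?_⟩
    rw [card_filter_fst_eq_count, hfst K hK]
    convert Multiset.count_eq_one_of_mem Finset.univ.nodup (Finset.mem_univ_val b)

theorem isSBP_initHom (hN : N.WellFormed) {M₀ : N.Marking} (hM₀ : M₀ ∈ N.init) :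
    IsSBP (initHom N (M₀.map Prod.fst)) := by
  refine ⟨isOccNet_initNet hM₀, ?_, fun e => e.elim, fun e => e.elim⟩
  refine Set.Subset.antisymm ?_ ?_
  · rintro _ ⟨_, ⟨c, rfl, hc⟩, rfl⟩
    simpa [Hom.mapMarking, Function.comp_def] using hc
  · intro M hM
    obtain ⟨c, rfl⟩ := exists_coloring M (hN.2 M hM M₀ hM₀)
    refine ⟨_, ⟨c, rfl, hM⟩, ?_⟩
    simp [Hom.mapMarking, Function.comp_def]

/-- The marking `M` is the marking of an instantiated configuration. -/
def Represented (h : Hom O N) (M : N.Marking) : Prop :=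
  ∃ C ι, O.IsConfig C ∧ O.IsInst C ι ∧ ∃ hfin : (O.cut C).Finite, mark h hfin ι = M

theorem represented_initHom (hN : N.WellFormed) {M₀ M : N.Marking} (hM₀ : M₀ ∈ N.init)
    (hM : M ∈ N.init) : Represented (initHom N (M₀.map Prod.fst)) M := by
  obtain ⟨c, rfl⟩ := exists_coloring M (hN.2 M hM M₀ hM₀)
  have hι : (initNet N (M₀.map Prod.fst)).IsInst ∅ (Sum.elim (fun ev => ev.1.elim) c) := by
    refine ⟨⟨_, ⟨c, rfl, hM⟩, fun b x hbx => ?_⟩, fun e => e.elim⟩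
    obtain ⟨_, -, h⟩ := Multiset.mem_map.1 hbx
    cases h
    rfl
  refine ⟨∅, _, ⟨fun e => e.elim, fun e => e.elim, _, hι⟩, hι, Set.toFinite _, ?_⟩
  have hnone : ∀ b, (initNet N (M₀.map Prod.fst)).condPre b = none := fun b =>
    condPre_eq_none_iff.2 fun e => e.elim
  have hcut : (Set.toFinite ((initNet N (M₀.map Prod.fst)).cut ∅)).toFinset =
      Finset.univ := by
    ext b
    have hb : b ∈ (initNet N (M₀.map Prod.fst)).B0 := hnone b
    rw [← cut_empty] at hb
    simpa using hb
  rw [mark, hcut]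
  refine Multiset.map_congr rfl fun b _ => ?_
  rw [valOf_of_none (hnone b)]
  rfl

theorem Represented.extend {h : Hom O N} (hU : O.UniqueProducer) {M : N.Marking}
    (hM : Represented h M) : Represented (extendHom h) M := by
  obtain ⟨τ⟩ := nonempty_newMode h
  obtain ⟨C, ι, hC, hι, hfin, rfl⟩ := hM
  exact ⟨_, _, isConfig_image_inl hU hC τ, isInst_extendAssign hU hι τ,
    finite_cut_image_inl hfin, mark_image_inl hU hfin _ ι τ⟩

theorem reach_of_reachSteps {k : ℕ} : ∀ {M : N.Marking}, N.ReachSteps k M → N.Reach M := by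
  induction k with
  | zero => exact fun h => Reach.init h
  | succ k ih =>
    rintro M ⟨M', t, σ, h, hf⟩
    exact Reach.step (ih h) hf

theorem Represented.step {h : Hom O N} (hh : IsSBP h) {M M' : N.Marking}
    (hM : Represented h M) {t : N.Trans} {σ : Var → Color} (hf : N.firesTo M t σ M')
    (ht : N.preFlow t ≠ 0) : Represented (extendHom h) M' := by
  have hU := hh.1.uniqueProducer
  have hO := isOccNet_extend (h := h) hh.1
  have hU' := hO.uniqueProducer
  obtain ⟨τ⟩ := nonempty_newMode h
  obtain ⟨C, ι, hC, hι, hfin, rfl⟩ := hM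
  have hfin₁ := finite_cut_image_inl (h := h) hfin
  have hC₁ := isConfig_image_inl hU hC τ
  have hι₁ := isInst_extendAssign hU hι τ
  obtain ⟨e, rfl, he⟩ := exists_extend_fires hU hC hι hfin hfin₁ τ hf.1
  have hpre := mem_cut_of_fires he
  have hpre' := fun bv hbv => (hpre bv hbv).1
  have heC : e ∉ Sum.inl '' C := by
    intro heC
    have hne : (HLNet.extend h).preFlow e ≠ 0 := by
      intro h0
      rw [(extendHom h).pre_eq, h0] at ht
      exact ht rfl
    obtain ⟨bv, hbv⟩ := Multiset.exists_mem_of_ne_zero hne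
    exact (hpre' bv hbv).2 ⟨e, heC, bv.2, hbv⟩
  have hι₂ := isInst_insert hU' hC₁.1 hι₁ heC he.1 hpre
  have hfin₂ := finite_cut_insert hO hC₁.1 heC hfin₁
  refine ⟨_, _, ⟨CausallyClosed.insert hU' hC₁.1 hpre',
    ConflictFree.insert hU' hC₁.1 hC₁.2.1 hpre', _, hι₂⟩, hι₂, hfin₂, ?_⟩
  have hstep := firesTo_mark_insert hO (extendHom h) hC₁.1 heC hpre'
    ((hι₂.2 e (Set.mem_insert _ _)).2 e Relation.ReflTransGen.refl) hfin₁ hfin₂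
  have hσ : (fun v => setMode (extendAssign ι τ) e σ (Sum.inl (e, v))) = σ :=
    funext fun v => setMode_self _ _ _ v
  rw [hσ] at hstep
  rw [hstep.2, mark_setMode hU' _ heC, mark_image_inl hU hfin, hf.2]

theorem exists_card_bound (hN : N.NetFinite) (hwf : N.WellFormed) (k : ℕ) :
    ∃ B, ∀ M, N.ReachSteps k M → M.card ≤ B := by
  have := hN.2
  induction k with
  | zero =>
    obtain ⟨M₀, hM₀⟩ := hwf.1
    refine ⟨M₀.card, fun M hM => ?_⟩
    have := congrArg Multiset.card (hwf.2 M hM M₀ hM₀)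
    simpa using this.le
  | succ k ih =>
    obtain ⟨B, hB⟩ := ih
    obtain ⟨D, hD⟩ := (Set.finite_range fun t => (N.postFlow t).card).bddAbove
    refine ⟨B + D, ?_⟩
    rintro _ ⟨M, t, σ, hM, -, rfl⟩
    have h1 := Multiset.card_le_card (tsub_le_self (a := M) (b := N.preMark t σ))
    have h2 : (N.postFlow t).card ≤ D := hD ⟨t, rfl⟩
    have h3 := hB M hM
    simp only [Multiset.card_add, postMark, Multiset.card_map]
    omega

theorem BoundedReach.exists_card_bound (hN : N.NetFinite) (hwf : N.WellFormed) {n : ℕ}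
    (hn : N.BoundedReach n) : ∃ B, ∀ M, N.Reach M → M.card ≤ B := by
  choose B hB using HLNet.exists_card_bound hN hwf
  refine ⟨(Finset.range (n + 1)).sup B, fun M hM => ?_⟩
  obtain ⟨k, hk, hM⟩ := hn M hM
  exact (hB k M hM).trans (Finset.le_sup (Finset.mem_range.2 (Nat.lt_succ_of_le hk)))

theorem BoundedReach.postFlow_eq_zero (hN : N.NetFinite) (hwf : N.WellFormed) {n : ℕ}
    (hn : N.BoundedReach n) {M : N.Marking} (hM : N.Reach M) {t : N.Trans}
    {σ : Var → Color} (hf : N.fires M t σ) (ht : N.preFlow t = 0) : N.postFlow t = 0 := by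
  obtain ⟨B, hB⟩ := hn.exists_card_bound hN hwf
  have hpre : N.preMark t σ = 0 := by simp [preMark, ht]
  have hiter : ∀ m : ℕ, N.Reach (M + m • N.postMark t σ) := by
    intro m
    induction m with
    | zero => simpa using hM
    | succ m ih =>
      refine Reach.step (t := t) (σ := σ) ih ⟨⟨hf.1, by simp [hpre]⟩, ?_⟩
      rw [hpre, tsub_zero, succ_nsmul, add_assoc]
  by_contra h0
  have hpos : 1 ≤ (N.postMark t σ).card := by
    rw [postMark, Multiset.card_map]
    exact Multiset.card_pos.2 h0
  have := hB _ (hiter (B + 1))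
  rw [Multiset.card_add, Multiset.card_nsmul] at this
  nlinarith

theorem exists_finite_representing (hN : N.NetFinite) (hwf : N.WellFormed) {n : ℕ}
    (hn : N.BoundedReach n) (k : ℕ) :
    ∃ (O : HLNet Color Var) (h : Hom O N), IsSBP h ∧ O.NetFinite ∧
      ∀ j ≤ k, ∀ M, N.ReachSteps j M → Represented h M := by
  induction k with
  | zero =>
    obtain ⟨M₀, hM₀⟩ := hwf.1
    refine ⟨_, _, isSBP_initHom hwf hM₀,
      ⟨inferInstanceAs (Finite (Fin _)), inferInstanceAs (Finite Empty)⟩, ?_⟩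
    rintro j hj M hM
    obtain rfl := Nat.le_zero.1 hj
    exact represented_initHom hwf hM₀ hM
  | succ k ih =>
    obtain ⟨O, h, hh, hfin, hrep⟩ := ih
    have hU := hh.1.uniqueProducer
    refine ⟨_, extendHom h, isSBP_extend hh, netFinite_extend hN hfin, fun j hj M hM => ?_⟩
    rcases Nat.le_succ_iff.1 hj with hj | rfl
    · exact (hrep j hj M hM).extend hU
    · obtain ⟨M₁, t, σ, hM₁, hf⟩ := hM
      have hrep₁ := hrep k le_rfl M₁ hM₁
      by_cases ht : N.preFlow t = 0
      · have ht' := hn.postFlow_eq_zero hN hwf (reach_of_reachSteps hM₁) hf.1 ht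
        obtain rfl : M = M₁ := by simpa [preMark, postMark, ht, ht'] using hf.2
        exact hrep₁.extend hU
      · exact hrep₁.step hh hf ht

theorem complete_extendHom {h : Hom O N} (hh : IsSBP h)
    (hrep : ∀ M, N.Reach M → Represented h M) : Complete (extendHom h) := by
  intro M hM
  have hU := hh.1.uniqueProducer
  obtain ⟨τ⟩ := nonempty_newMode h
  obtain ⟨C, ι, hC, hι, hfin, rfl⟩ := hrep M hM
  refine ⟨_, isConfig_image_inl hU hC τ, Set.subset_univ _, _, isInst_extendAssign hU hι τ,
    finite_cut_image_inl hfin, (mark_image_inl hU hfin _ ι τ).symm, fun t σ hf => ?_⟩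
  obtain ⟨e, he⟩ := exists_extend_fires hU hC hι hfin (finite_cut_image_inl hfin) τ hf
  exact ⟨e, Set.mem_univ _, he⟩

end Existence

end HLNet

/-- For a finite high-level Petri net `N = (𝔑, ℳ0)` there exists a
finite and complete prefix of the symbolic unfolding `Υ(N)` if and only if there exists
a bound `n ∈ ℕ` such that every marking in `R(N)` is reachable from a marking in `ℳ0`
by firing at most `n` transitions. -/
theorem exists_finite_complete_prefix_iff_bounded_reach {Color Var : Type}
    (N : HLNet Color Var) (hfin : N.NetFinite) (hwf : N.WellFormed) :
    (∃ (O : HLNet Color Var) (h : HLNet.Hom O N),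
        HLNet.IsSBP h ∧ O.NetFinite ∧ HLNet.Complete h) ↔
      ∃ n : ℕ, N.BoundedReach n := by
  constructor
  · rintro ⟨O, h, hh, hO, hc⟩
    exact ⟨_, HLNet.boundedReach_of_complete hh hO hc⟩
  · rintro ⟨n, hn⟩
    obtain ⟨O, h, hh, hO, hrep⟩ := HLNet.exists_finite_representing hfin hwf hn n
    refine ⟨_, HLNet.extendHom h, HLNet.isSBP_extend hh, HLNet.netFinite_extend hfin hO,
      HLNet.complete_extendHom hh fun M hM => ?_⟩
    obtain ⟨k, hk, hM⟩ := hn M hM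
    exact hrep k hk M hM
end
end
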